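/- Let s₀ > 1/2 and s ≥ s₀. There is a constant C > 0 (depending on s, s₀ and the dyadic partition) such that for all smooth functions a, g : 𝕋² → ℝ, ( Σ_{k≥−1} 2^{2ks} ‖Δ^v_k(T^v_g a)‖²_{L²_v(L^{4/3}_h)} )^{1/2} ≤ C ‖g‖_{H^{0,s₀}} ‖a‖_{H^{1/4,s}}. -/

import Mathlib

open MeasureTheory Real Complex Filter Set

noncomputable section

namespace Aniso

/-- Fundamental domain `(0, 2π]` for the circle of circumference `2π`. -/
def I2pi : Set ℝ := Set.Ioc 0 (2 * π)

/-- Fundamental domain for the 2-torus `𝕋² = (ℝ/2πℤ)²`. -/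
def Q2 : Set (ℝ × ℝ) := I2pi ×ˢ I2pi

/-- Integral over the torus of a real function. -/
def tintR (f : ℝ × ℝ → ℝ) : ℝ := ∫ x in Q2, f x

/-- Smoothness of a scalar field. -/
def Smooth (f : ℝ × ℝ → ℝ) : Prop := ContDiff ℝ (⊤ : ℕ∞) f

/-- Smoothness of a vector field. -/
def SmoothV (u : ℝ × ℝ → ℝ × ℝ) : Prop := ContDiff ℝ (⊤ : ℕ∞) u

/-- `2π`-periodicity in each variable: this encodes being a function on the torus. -/
def Per (f : ℝ × ℝ → ℝ) : Prop :=
  (∀ x : ℝ × ℝ, f (x.1 + 2 * π, x.2) = f x) ∧ (∀ x : ℝ × ℝ, f (x.1, x.2 + 2 * π) = f x)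

def PerV (u : ℝ × ℝ → ℝ × ℝ) : Prop :=
  Per (fun x => (u x).1) ∧ Per (fun x => (u x).2)

/-- Partial derivative in the horizontal variable `x₁`. -/
def pd1 (f : ℝ × ℝ → ℝ) : ℝ × ℝ → ℝ := fun x => fderiv ℝ f x (1, 0)

/-- Partial derivative in the vertical variable `x₂`. -/
def pd2 (f : ℝ × ℝ → ℝ) : ℝ × ℝ → ℝ := fun x => fderiv ℝ f x (0, 1)

def comp1 (u : ℝ × ℝ → ℝ × ℝ) : ℝ × ℝ → ℝ := fun x => (u x).1
def comp2 (u : ℝ × ℝ → ℝ × ℝ) : ℝ × ℝ → ℝ := fun x => (u x).2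

def pd1V (u : ℝ × ℝ → ℝ × ℝ) : ℝ × ℝ → ℝ × ℝ := fun x => (pd1 (comp1 u) x, pd1 (comp2 u) x)
def pd2V (u : ℝ × ℝ → ℝ × ℝ) : ℝ × ℝ → ℝ × ℝ := fun x => (pd2 (comp1 u) x, pd2 (comp2 u) x)

/-- Divergence-free condition `∂₁u¹ + ∂₂u² = 0`. -/
def DivFree (u : ℝ × ℝ → ℝ × ℝ) : Prop :=
  ∀ x, pd1 (comp1 u) x + pd2 (comp2 u) x = 0

/-- The transport term `u·∇v`, with components `u¹∂₁vʲ + u²∂₂vʲ`. -/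
def advect (u v : ℝ × ℝ → ℝ × ℝ) : ℝ × ℝ → ℝ × ℝ := fun x =>
  ((u x).1 * pd1 (comp1 v) x + (u x).2 * pd2 (comp1 v) x,
   (u x).1 * pd1 (comp2 v) x + (u x).2 * pd2 (comp2 v) x)

/-- L² inner product of real vector fields on the torus (summed over components). -/
def ipV (u v : ℝ × ℝ → ℝ × ℝ) : ℝ := tintR fun x => (u x).1 * (v x).1 + (u x).2 * (v x).2

/-- The trilinear form `b(u,v,w) = ∫ (u·∇v)·w`. -/
def b3 (u v w : ℝ × ℝ → ℝ × ℝ) : ℝ := ipV (advect u v) w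

/-- L² norm of a scalar function on the torus. -/
def L2 (f : ℝ × ℝ → ℝ) : ℝ := Real.sqrt (tintR fun x => f x ^ 2)

/-- L² norm of a vector field on the torus. -/
def L2V (u : ℝ × ℝ → ℝ × ℝ) : ℝ := Real.sqrt (tintR fun x => (u x).1 ^ 2 + (u x).2 ^ 2)

/-- Fourier coefficient of a complex-valued function on the torus. -/
def fcC (f : ℝ × ℝ → ℂ) (k : ℤ × ℤ) : ℂ :=
  (1 / (2 * π) ^ 2 : ℂ) *
    ∫ x in Q2, f x * Complex.exp (-(Complex.I) * ((k.1 : ℂ) * (x.1 : ℂ) + (k.2 : ℂ) * (x.2 : ℂ)))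

/-- Fourier coefficient of a real-valued function on the torus. -/
def fc (f : ℝ × ℝ → ℝ) (k : ℤ × ℤ) : ℂ := fcC (fun x => (f x : ℂ)) k

/-- Anisotropic Sobolev weight `(1+|k₁|²)^s (1+|k₂|²)^{s'}`. -/
def aw (s s' : ℝ) (k : ℤ × ℤ) : ℝ :=
  (1 + (k.1 : ℝ) ^ 2) ^ s * (1 + (k.2 : ℝ) ^ 2) ^ s'

/-- Square of the anisotropic Sobolev norm `H^{s,s'}` of a scalar function. -/
def HSq (s s' : ℝ) (f : ℝ × ℝ → ℝ) : ℝ := ∑' k : ℤ × ℤ, aw s s' k * ‖fc f k‖ ^ 2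

/-- Anisotropic Sobolev norm `H^{s,s'}` of a scalar function. -/
def HN (s s' : ℝ) (f : ℝ × ℝ → ℝ) : ℝ := Real.sqrt (HSq s s' f)

/-- Anisotropic Sobolev norm `H^{s,s'}` of a vector field. -/
def HNV (s s' : ℝ) (u : ℝ × ℝ → ℝ × ℝ) : ℝ :=
  Real.sqrt (HSq s s' (comp1 u) + HSq s s' (comp2 u))

/-- Mixed norm `L^∞_h(L²_v)`. -/
def LinfhL2v (f : ℝ × ℝ → ℝ) : ℝ :=
  essSup (fun x1 : ℝ => Real.sqrt (∫ x2 in I2pi, f (x1, x2) ^ 2)) (volume.restrict I2pi)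

/-- Mixed norm `L²_h(L^∞_v)`. -/
def L2hLinfv (f : ℝ × ℝ → ℝ) : ℝ :=
  Real.sqrt (∫ x1 in I2pi, (essSup (fun x2 : ℝ => |f (x1, x2)|) (volume.restrict I2pi)) ^ 2)

/-- Mixed norm `L²_v(L^{4/3}_h)`. -/
def L2vL43h {E : Type*} [NormedAddCommGroup E] (f : ℝ × ℝ → E) : ℝ :=
  Real.sqrt (∫ x2 in I2pi, (∫ x1 in I2pi, ‖f (x1, x2)‖ ^ ((4 : ℝ)/3)) ^ ((3 : ℝ)/2))

/-- Mixed norm `L^∞_v(L²_h)`. -/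
def LinfvL2h {E : Type*} [NormedAddCommGroup E] (f : ℝ × ℝ → E) : ℝ :=
  essSup (fun x2 : ℝ => Real.sqrt (∫ x1 in I2pi, ‖f (x1, x2)‖ ^ 2)) (volume.restrict I2pi)

/-- Mixed norm `L²_v(L⁴_h)`. -/
def L2vL4h {E : Type*} [NormedAddCommGroup E] (f : ℝ × ℝ → E) : ℝ :=
  Real.sqrt (∫ x2 in I2pi, Real.sqrt (∫ x1 in I2pi, ‖f (x1, x2)‖ ^ 4))

/-- One-dimensional Fourier coefficient on the circle of circumference `2π`. -/
def fc1 (g : ℝ → ℂ) (n : ℤ) : ℂ :=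
  (1 / (2 * π) : ℂ) * ∫ x in I2pi, g x * Complex.exp (-(Complex.I) * ((n : ℂ) * (x : ℂ)))

/-- Square of the 1-d Sobolev norm `H^s(𝕋)`. -/
def H1Sq (s : ℝ) (g : ℝ → ℂ) : ℝ := ∑' n : ℤ, (1 + (n : ℝ) ^ 2) ^ s * ‖fc1 g n‖ ^ 2

/-- Mixed norm `L²_v(H^s_h)`. -/
def L2vHsh (s : ℝ) (f : ℝ × ℝ → ℂ) : ℝ :=
  Real.sqrt (∫ x2 in I2pi, H1Sq s (fun x1 => f (x1, x2)))

/-- A dyadic partition of unity `(χ, θ)` on `ℝ`. -/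
structure IsDyadicPartition (χ θ : ℝ → ℝ) : Prop where
  smooth_chi : ContDiff ℝ (⊤ : ℕ∞) χ
  smooth_theta : ContDiff ℝ (⊤ : ℕ∞) θ
  nonneg_chi : ∀ z, 0 ≤ χ z
  nonneg_theta : ∀ z, 0 ≤ θ z
  even_chi : ∀ z, χ (-z) = χ z
  even_theta : ∀ z, θ (-z) = θ z
  chi_support : ∃ R > 0, ∀ z, R ≤ |z| → χ z = 0
  theta_support : ∃ r R : ℝ, 0 < r ∧ r < R ∧ ∀ z, (|z| < r ∨ R < |z|) → θ z = 0
  partition : ∀ z : ℝ, χ z + ∑' j : ℕ, θ ((2 : ℝ) ^ (-(j : ℤ)) * z) = 1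
  chi_theta_disj : ∀ j : ℕ, 1 ≤ j → ∀ z, χ z * θ ((2 : ℝ) ^ (-(j : ℤ)) * z) = 0
  theta_theta_disj : ∀ i j : ℕ, 1 < |(i : ℤ) - (j : ℤ)| → ∀ z,
    θ ((2 : ℝ) ^ (-(i : ℤ)) * z) * θ ((2 : ℝ) ^ (-(j : ℤ)) * z) = 0

/-- The Fourier multiplier symbol of the vertical Littlewood–Paley block `Δ^v_j`. -/
def blockSymb (χ θ : ℝ → ℝ) (j : ℤ) (z : ℝ) : ℝ :=
  if j = -1 then χ |z| else if 0 ≤ j then θ ((2 : ℝ) ^ (-j) * |z|) else 0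

/-- The Fourier multiplier symbol of the vertical low-frequency cut-off `S^v_j`. -/
def lowSymb (χ θ : ℝ → ℝ) (j : ℤ) (z : ℝ) : ℝ :=
  ∑ j' ∈ Finset.Icc (-1 : ℤ) (j - 2), blockSymb χ θ j' z

/-- The character `e^{ik·x}`. -/
def eK (k : ℤ × ℤ) (x : ℝ × ℝ) : ℂ :=
  Complex.exp (Complex.I * ((k.1 : ℂ) * (x.1 : ℂ) + (k.2 : ℂ) * (x.2 : ℂ)))

/-- Vertical Littlewood–Paley block `Δ^v_j` of a complex-valued function. -/
def LPC (χ θ : ℝ → ℝ) (j : ℤ) (f : ℝ × ℝ → ℂ) : ℝ × ℝ → ℂ :=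
  fun x => ∑' k : ℤ × ℤ, (blockSymb χ θ j k.2 : ℂ) * fcC f k * eK k x

/-- Vertical Littlewood–Paley block `Δ^v_j` of a real-valued function. -/
def LP (χ θ : ℝ → ℝ) (j : ℤ) (f : ℝ × ℝ → ℝ) : ℝ × ℝ → ℂ :=
  LPC χ θ j fun x => (f x : ℂ)

/-- Vertical low-frequency cut-off `S^v_j` of a complex-valued function. -/
def SvC (χ θ : ℝ → ℝ) (j : ℤ) (f : ℝ × ℝ → ℂ) : ℝ × ℝ → ℂ :=
  fun x => ∑' k : ℤ × ℤ, (lowSymb χ θ j k.2 : ℂ) * fcC f k * eK k x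

/-- Vertical low-frequency cut-off `S^v_j` of a real-valued function. -/
def Sv (χ θ : ℝ → ℝ) (j : ℤ) (f : ℝ × ℝ → ℝ) : ℝ × ℝ → ℂ :=
  SvC χ θ j fun x => (f x : ℂ)

/-- Componentwise Littlewood–Paley block of a vector field. -/
def LPV (χ θ : ℝ → ℝ) (j : ℤ) (u : ℝ × ℝ → ℝ × ℝ) : ℝ × ℝ → ℂ × ℂ :=
  fun x => (LP χ θ j (comp1 u) x, LP χ θ j (comp2 u) x)

/-- Componentwise low-frequency cut-off of a vector field. -/
def SvV (χ θ : ℝ → ℝ) (j : ℤ) (u : ℝ × ℝ → ℝ × ℝ) : ℝ × ℝ → ℂ × ℂ :=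
  fun x => (Sv χ θ j (comp1 u) x, Sv χ θ j (comp2 u) x)

/-- L² inner product of complex-valued functions on the torus. -/
def ipC (f g : ℝ × ℝ → ℂ) : ℂ := ∫ x in Q2, f x * (starRingEnd ℂ) (g x)

/-- L² inner product of complex vector fields on the torus (summed over components). -/
def ipCV (f g : ℝ × ℝ → ℂ × ℂ) : ℂ :=
  ∫ x in Q2, ((f x).1 * (starRingEnd ℂ) ((g x).1) + (f x).2 * (starRingEnd ℂ) ((g x).2))

/-- The vertical paraproduct `T^v_a g = Σ_j S^v_{j-1}a · Δ^v_j g`. -/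
def Tv (χ θ : ℝ → ℝ) (a g : ℝ × ℝ → ℝ) : ℝ × ℝ → ℂ :=
  fun x => ∑' j : ℤ, Sv χ θ (j - 1) a x * LP χ θ j g x

/-- The vertical remainder `R^v(a,g) = Σ_{|j-j'|≤1} Δ^v_j a · Δ^v_{j'} g`. -/
def Rv (χ θ : ℝ → ℝ) (a g : ℝ × ℝ → ℝ) : ℝ × ℝ → ℂ :=
  fun x => ∑' p : ℤ × ℤ, if |p.1 - p.2| ≤ 1 then LP χ θ p.1 a x * LP χ θ p.2 g x else 0

/-! ### Inequalities for extended nonnegative sums and integrals -/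

lemma tsum_mul_sq_le {ι : Type*} (a b : ι → ENNReal) :
    (∑' i, a i * b i) ^ 2 ≤ (∑' i, a i ^ 2) * ∑' i, b i ^ 2 := by
  let _ : MeasurableSpace ι := ⊤
  have h := ENNReal.lintegral_mul_le_Lp_mul_Lq (Measure.count : Measure ι)
    Real.HolderConjugate.two_two (f := a) (g := b)
    measurable_from_top.aemeasurable measurable_from_top.aemeasurable
  simp only [Pi.mul_apply, lintegral_count] at h
  calc (∑' i, a i * b i) ^ 2
      ≤ ((∑' i, a i ^ (2 : ℝ)) ^ (1 / 2 : ℝ) * (∑' i, b i ^ (2 : ℝ)) ^ (1 / 2 : ℝ)) ^ 2 := by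
        gcongr
    _ = (∑' i, a i ^ 2) * ∑' i, b i ^ 2 := by
        rw [mul_pow]
        simp only [← ENNReal.rpow_natCast, ← ENNReal.rpow_mul]
        norm_num

/-- Young's inequality `ℓ¹ * ℓ² ⊆ ℓ²` on `ℤ`. -/
lemma tsum_conv_sq_le (u v : ℤ → ENNReal) :
    ∑' n, (∑' p, u p * v (n - p)) ^ 2 ≤ (∑' p, u p) ^ 2 * ∑' q, v q ^ 2 := by
  have hsq : ∀ t : ENNReal, (t ^ (1 / 2 : ℝ)) ^ 2 = t := fun t => by
    rw [← ENNReal.rpow_natCast, ← ENNReal.rpow_mul]; norm_num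
  calc ∑' n, (∑' p, u p * v (n - p)) ^ 2
      ≤ ∑' n, (∑' p, u p) * ∑' p, u p * v (n - p) ^ 2 := by
        refine ENNReal.tsum_le_tsum fun n => ?_
        have h := tsum_mul_sq_le (fun p => u p ^ (1 / 2 : ℝ))
          (fun p => u p ^ (1 / 2 : ℝ) * v (n - p))
        simp only [mul_pow, hsq, ← mul_assoc] at h
        refine le_trans (le_of_eq ?_) h
        congr 2
        ext p
        rw [← sq, hsq]
    _ = (∑' p, u p) * ∑' p, u p * ∑' n, v (n - p) ^ 2 := by
        rw [ENNReal.tsum_mul_left, ENNReal.tsum_comm]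
        simp_rw [ENNReal.tsum_mul_left]
    _ = (∑' p, u p) ^ 2 * ∑' q, v q ^ 2 := by
        have : ∀ p : ℤ, ∑' n, v (n - p) ^ 2 = ∑' q, v q ^ 2 := fun p =>
          (Equiv.subRight p).tsum_eq (fun q => v q ^ 2)
        simp_rw [this, ENNReal.tsum_mul_right]
        ring

/-- The triangle inequality in `L²`, in squared form, for countable sums. -/
lemma lintegral_tsum_sq_le {α ι : Type*} [MeasurableSpace α] {μ : Measure α} [Countable ι]
    {f : ι → α → ENNReal} (hf : ∀ i, Measurable (f i)) {N : ι → ENNReal}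
    (hN : ∀ i, ∫⁻ x, f i x ^ 2 ∂μ ≤ N i ^ 2) :
    ∫⁻ x, (∑' i, f i x) ^ 2 ∂μ ≤ (∑' i, N i) ^ 2 := by
  have hfg : ∀ i j, ∫⁻ x, f i x * f j x ∂μ ≤ N i * N j := fun i j => by
    have h := ENNReal.lintegral_mul_le_Lp_mul_Lq μ Real.HolderConjugate.two_two
      (hf i).aemeasurable (hf j).aemeasurable
    refine h.trans ?_
    have hroot : ∀ i, (∫⁻ x, f i x ^ (2 : ℝ) ∂μ) ^ (1 / 2 : ℝ) ≤ N i := fun i => by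
      calc (∫⁻ x, f i x ^ (2 : ℝ) ∂μ) ^ (1 / 2 : ℝ) ≤ (N i ^ 2) ^ (1 / 2 : ℝ) := by
            gcongr
            simpa using hN i
        _ = N i := by
            rw [← ENNReal.rpow_natCast, ← ENNReal.rpow_mul]; norm_num
    exact mul_le_mul' (hroot i) (hroot j)
  calc ∫⁻ x, (∑' i, f i x) ^ 2 ∂μ = ∫⁻ x, ∑' i, ∑' j, f i x * f j x ∂μ := by
        simp_rw [sq, ENNReal.tsum_mul_left, ENNReal.tsum_mul_right]
    _ = ∑' i, ∑' j, ∫⁻ x, f i x * f j x ∂μ := by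
        have hm : ∀ i j, Measurable fun x => f i x * f j x := fun i j => (hf i).mul (hf j)
        rw [lintegral_tsum fun i => (Measurable.tsum fun j => hm i j).aemeasurable]
        congr with i
        rw [lintegral_tsum fun j => (hm i j).aemeasurable]
    _ ≤ ∑' i, ∑' j, N i * N j :=
        ENNReal.tsum_le_tsum fun i => ENNReal.tsum_le_tsum fun j => hfg i j
    _ = (∑' i, N i) ^ 2 := by
        simp_rw [sq, ENNReal.tsum_mul_left, ENNReal.tsum_mul_right]

/-- Hölder's inequality for `L^{4/3}` against a weighted `L²` norm. -/
lemma lintegral_rpow_four_thirds_le {α : Type*} [MeasurableSpace α] {μ : Measure α}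
    {F V : α → ENNReal} (hF : Measurable F) (hV : Measurable V) (hV0 : ∀ x, V x ≠ 0)
    (hVt : ∀ᵐ x ∂μ, V x ≠ ⊤) :
    (∫⁻ x, F x ^ (4 / 3 : ℝ) ∂μ) ^ (3 / 2 : ℝ) ≤
      (∫⁻ x, F x ^ 2 * (V x)⁻¹ ∂μ) * (∫⁻ x, V x ^ 2 ∂μ) ^ (1 / 2 : ℝ) := by
  have hpq : (3 / 2 : ℝ).HolderConjugate 3 := by
    rw [Real.holderConjugate_iff]; norm_num
  have h := ENNReal.lintegral_mul_le_Lp_mul_Lq μ hpq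
    (f := fun x => F x ^ (4 / 3 : ℝ) * V x ^ (-(2 / 3) : ℝ)) (g := fun x => V x ^ (2 / 3 : ℝ))
    ((hF.pow_const _).mul (hV.pow_const _)).aemeasurable (hV.pow_const _).aemeasurable
  have e1 : ∫⁻ x, F x ^ (4 / 3 : ℝ) ∂μ = ∫⁻ x, ((fun x => F x ^ (4 / 3 : ℝ) *
      V x ^ (-(2 / 3) : ℝ)) * fun x => V x ^ (2 / 3 : ℝ)) x ∂μ := by
    refine lintegral_congr_ae ?_
    filter_upwards [hVt] with x hx
    rw [Pi.mul_apply, mul_assoc, ← ENNReal.rpow_add _ _ (hV0 x) hx]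
    simp
  have e2 : ∀ x, (F x ^ (4 / 3 : ℝ) * V x ^ (-(2 / 3) : ℝ)) ^ (3 / 2 : ℝ) =
      F x ^ 2 * (V x)⁻¹ := fun x => by
    rw [ENNReal.mul_rpow_of_nonneg _ _ (by norm_num), ← ENNReal.rpow_mul, ← ENNReal.rpow_mul,
      ← ENNReal.rpow_neg_one, ← ENNReal.rpow_natCast]
    norm_num
  have e3 : ∀ x, (V x ^ (2 / 3 : ℝ)) ^ (3 : ℝ) = V x ^ 2 := fun x => by
    rw [← ENNReal.rpow_mul, ← ENNReal.rpow_natCast]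
    norm_num
  simp only [e2, e3] at h
  rw [e1]
  calc _ ≤ ((∫⁻ x, F x ^ 2 * (V x)⁻¹ ∂μ) ^ (1 / (3 / 2) : ℝ) *
        (∫⁻ x, V x ^ 2 ∂μ) ^ (1 / 3 : ℝ)) ^ (3 / 2 : ℝ) := by gcongr
    _ = _ := by
        rw [ENNReal.mul_rpow_of_nonneg _ _ (by norm_num), ← ENNReal.rpow_mul,
          ← ENNReal.rpow_mul]
        norm_num

lemma ofReal_integral_le_lintegral_ofReal {α : Type*} [MeasurableSpace α] {μ : Measure α}
    {f : α → ℝ} (hf : ∀ x, 0 ≤ f x) :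
    ENNReal.ofReal (∫ x, f x ∂μ) ≤ ∫⁻ x, ENNReal.ofReal (f x) ∂μ := by
  by_cases h : Integrable f μ
  · exact (ofReal_integral_eq_lintegral_ofReal h (Eventually.of_forall hf)).le
  · simp [integral_undef h]

/-! ### Absolutely convergent trigonometric series on the circle -/

/-- The character `e^{inx}` of the circle. -/
def ch (n : ℤ) (x : ℝ) : ℂ := Complex.exp (Complex.I * ((n : ℂ) * (x : ℂ)))

lemma ch_add (n m : ℤ) (x : ℝ) : ch (n + m) x = ch n x * ch m x := by
  simp only [ch, ← Complex.exp_add]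
  congr 1
  push_cast
  ring

lemma norm_ch (n : ℤ) (x : ℝ) : ‖ch n x‖ = 1 := by
  rw [ch, show Complex.I * ((n : ℂ) * (x : ℂ)) = ((n * x : ℝ) : ℂ) * Complex.I by
    push_cast; ring, Complex.norm_exp_ofReal_mul_I]

@[fun_prop]
lemma continuous_ch (n : ℤ) : Continuous (ch n) := by
  unfold ch; fun_prop

lemma conj_ch (n : ℤ) (x : ℝ) : (starRingEnd ℂ) (ch n x) = ch (-n) x := by
  rw [ch, ch, ← Complex.exp_conj]
  congr 1
  simp

lemma eK_eq (k : ℤ × ℤ) (x : ℝ × ℝ) : eK k x = ch k.1 x.1 * ch k.2 x.2 := by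
  rw [eK, ch, ch, ← Complex.exp_add]
  congr 1
  ring

lemma two_pi_nonneg : (0 : ℝ) ≤ 2 * π := by positivity

lemma volume_I2pi : volume I2pi = ENNReal.ofReal (2 * π) := by
  simp [I2pi]

lemma integral_ch (n : ℤ) : ∫ x in I2pi, ch n x = if n = 0 then (2 * π : ℂ) else 0 := by
  rw [I2pi, ← intervalIntegral.integral_of_le two_pi_nonneg]
  split_ifs with h
  · subst h
    simp [ch]
  · have hc : Complex.I * (n : ℂ) ≠ 0 := by simp [h]
    have := integral_exp_mul_complex (a := 0) (b := 2 * π) hc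
    simp only [ch, ← mul_assoc]
    rw [this]
    have h1 : Complex.I * (n : ℂ) * ((2 * π : ℝ) : ℂ) = n * (2 * π * Complex.I) := by
      push_cast; ring
    rw [h1, Complex.exp_int_mul_two_pi_mul_I]
    simp

lemma integrableOn_I2pi_of_continuous {E : Type*} [NormedAddCommGroup E] {f : ℝ → E}
    (hf : Continuous f) : IntegrableOn f I2pi :=
  (hf.integrableOn_Icc (a := 0) (b := 2 * π)).mono_set Ioc_subset_Icc_self

lemma integral_tsum_ch {ι : Type*} [Countable ι] {d : ι → ℂ} (hd : Summable fun i => ‖d i‖)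
    (ν : ι → ℤ) :
    ∫ x in I2pi, ∑' i, d i * ch (ν i) x =
      ∑' i, d i * (if ν i = 0 then (2 * π : ℂ) else 0) := by
  rw [← integral_tsum_of_summable_integral_norm]
  · congr with i
    rw [integral_const_mul, integral_ch]
  · intro i
    exact integrableOn_I2pi_of_continuous (by fun_prop)
  · simp only [norm_mul, norm_ch, mul_one, integral_const]
    exact hd.mul_left _

lemma summable_mul_ch {ι : Type*} {d : ι → ℂ} (hd : Summable fun i => ‖d i‖) (ν : ι → ℤ)
    (x : ℝ) : Summable fun i => ‖d i * ch (ν i) x‖ := by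
  simpa [norm_ch] using hd

lemma continuous_tsum_ch {ι : Type*} {d : ι → ℂ} (hd : Summable fun i => ‖d i‖) (ν : ι → ℤ) :
    Continuous fun x => ∑' i, d i * ch (ν i) x :=
  continuous_tsum (fun i => by fun_prop) hd fun i x => by simp [norm_ch]

lemma enorm_tsum_le {ι : Type*} (f : ι → ℂ) : ‖∑' i, f i‖ₑ ≤ ∑' i, ‖f i‖ₑ := by
  by_cases h : Summable fun i => ‖f i‖
  · have h1 := norm_tsum_le_tsum_norm h
    have h2 : ENNReal.ofReal (∑' i, ‖f i‖) = ∑' i, ‖f i‖ₑ := by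
      rw [ENNReal.ofReal_tsum_of_nonneg (fun _ => norm_nonneg _) h]
      simp
    rw [← h2, ← ofReal_norm]
    exact ENNReal.ofReal_le_ofReal h1
  · rw [tsum_eq_zero_of_not_summable (fun h' => h h'.norm)]
    simp

/-- Parseval's identity for absolutely convergent trigonometric series. -/
lemma lintegral_enorm_tsum_ch_sq {c : ℤ → ℂ} (hc : Summable fun n => ‖c n‖) :
    ∫⁻ x in I2pi, ‖∑' n, c n * ch n x‖ₑ ^ 2 = ENNReal.ofReal (2 * π) * ∑' n, ‖c n‖ₑ ^ 2 := by
  set f : ℝ → ℂ := fun x => ∑' n, c n * ch n x with hf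
  have hcont : Continuous f := continuous_tsum_ch hc fun n => n
  have hd : Summable fun p : ℤ × ℤ => ‖c p.1 * (starRingEnd ℂ) (c p.2)‖ :=
    Summable.mul_norm (f := c) (g := fun n => (starRingEnd ℂ) (c n)) hc (by simpa using hc)
  have hprod : ∀ x, ((‖f x‖ ^ 2 : ℝ) : ℂ) =
      ∑' p : ℤ × ℤ, (c p.1 * (starRingEnd ℂ) (c p.2)) * ch (p.1 - p.2) x := fun x => by
    have h1 : (starRingEnd ℂ) (f x) = ∑' n, (starRingEnd ℂ) (c n) * ch (-n) x := by
      rw [hf, Complex.conj_tsum]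
      simp [conj_ch]
    have h2 : ((‖f x‖ ^ 2 : ℝ) : ℂ) = f x * (starRingEnd ℂ) (f x) := by
      rw [Complex.mul_conj, Complex.normSq_eq_norm_sq]
    rw [h2, h1, hf, tsum_mul_tsum_of_summable_norm (summable_mul_ch hc (fun n => n) x)
      (summable_mul_ch (d := fun n => (starRingEnd ℂ) (c n)) (by simpa using hc) (fun n => -n) x)]
    congr with p
    rw [sub_eq_add_neg, ch_add]
    ring
  have hsq : Summable fun n => ‖c n‖ ^ 2 := by
    have h := hd.comp_injective (i := fun n : ℤ => (n, n)) (fun a b h => by simpa using h)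
    simpa [Function.comp_def, sq] using h
  have hint : ∫ x in I2pi, ‖f x‖ ^ 2 = 2 * π * ∑' n, ‖c n‖ ^ 2 := by
    have : ((∫ x in I2pi, ‖f x‖ ^ 2 : ℝ) : ℂ) = ((2 * π * ∑' n, ‖c n‖ ^ 2 : ℝ) : ℂ) := by
      rw [← integral_complex_ofReal]
      simp_rw [hprod]
      rw [integral_tsum_ch hd fun p => p.1 - p.2]
      rw [Summable.tsum_prod]
      · have : ∀ n : ℤ, ∑' m, c n * (starRingEnd ℂ) (c m) *
            (if n - m = 0 then (2 * π : ℂ) else 0) = 2 * π * ((‖c n‖ ^ 2 : ℝ) : ℂ) := fun n => by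
          rw [tsum_eq_single n]
          · simp [Complex.mul_conj, Complex.normSq_eq_norm_sq, mul_comm]
          · intro m hm
            rw [if_neg (by omega), mul_zero]
        simp_rw [this, tsum_mul_left]
        push_cast
        rfl
      · refine Summable.of_norm_bounded (g := fun p : ℤ × ℤ =>
          ‖c p.1 * (starRingEnd ℂ) (c p.2)‖ * (2 * π)) (hd.mul_right _) fun p => ?_
        rw [norm_mul]
        gcongr
        split_ifs <;> simp [abs_of_pos Real.pi_pos, Real.pi_pos.le]
    exact_mod_cast this
  have h1 : ∀ x, ‖f x‖ₑ ^ 2 = ENNReal.ofReal (‖f x‖ ^ 2) := fun x => by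
    rw [ENNReal.ofReal_pow (norm_nonneg _), ofReal_norm]
  calc ∫⁻ x in I2pi, ‖f x‖ₑ ^ 2 = ENNReal.ofReal (∫ x in I2pi, ‖f x‖ ^ 2) := by
        rw [ofReal_integral_eq_lintegral_ofReal]
        · simp_rw [h1]
        · exact integrableOn_I2pi_of_continuous (by fun_prop)
        · exact Eventually.of_forall fun x => by positivity
    _ = ENNReal.ofReal (2 * π) * ∑' n, ‖c n‖ₑ ^ 2 := by
        rw [hint, ENNReal.ofReal_mul two_pi_nonneg,
          ENNReal.ofReal_tsum_of_nonneg (fun _ => by positivity) hsq]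
        simp_rw [ENNReal.ofReal_pow (norm_nonneg _), ofReal_norm]

/-! ### Symbols of the vertical blocks and of the paraproduct -/

section Symbols

variable {χ θ : ℝ → ℝ}

lemma blockSymb_neg_one (z : ℝ) : blockSymb χ θ (-1) z = χ |z| := by simp [blockSymb]

lemma blockSymb_natCast (n : ℕ) (z : ℝ) :
    blockSymb χ θ n z = θ ((2 : ℝ) ^ (-(n : ℤ)) * |z|) := by
  rw [blockSymb, if_neg (by omega), if_pos (by omega)]

lemma blockSymb_of_lt {j : ℤ} (hj : j < -1) (z : ℝ) : blockSymb χ θ j z = 0 := by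
  rw [blockSymb, if_neg (by omega), if_neg (by omega)]

lemma blockSymb_nonneg (hp : IsDyadicPartition χ θ) (j : ℤ) (z : ℝ) :
    0 ≤ blockSymb χ θ j z := by
  unfold blockSymb
  split_ifs
  exacts [hp.nonneg_chi _, hp.nonneg_theta _, le_rfl]

lemma summable_theta (hp : IsDyadicPartition χ θ) (z : ℝ) :
    Summable fun j : ℕ => θ ((2 : ℝ) ^ (-(j : ℤ)) * z) := by
  obtain ⟨r, R, hr, -, hθ⟩ := hp.theta_support
  have hlim : Tendsto (fun j : ℕ => (1 / 2 : ℝ) ^ j * |z|) atTop (nhds 0) := by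
    simpa using (tendsto_pow_atTop_nhds_zero_of_lt_one (r := (1 / 2 : ℝ)) (by norm_num)
      (by norm_num)).mul_const |z|
  obtain ⟨N, hN⟩ := eventually_atTop.1 (hlim.eventually_lt_const hr)
  refine summable_of_ne_finset_zero (s := Finset.range N) fun j hj => hθ _ (Or.inl ?_)
  have := hN j (by simpa using hj)
  have hpow : |(2 : ℝ) ^ (-(j : ℤ))| = (1 / 2) ^ j := by simp
  rwa [abs_mul, hpow]

lemma sum_blockSymb_le_one (hp : IsDyadicPartition χ θ) (z : ℝ) (S : Finset ℤ) :
    ∑ j ∈ S, blockSymb χ θ j z ≤ 1 := by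
  obtain ⟨N, hN⟩ : ∃ N : ℕ, ∀ j ∈ S, j < N := by
    obtain ⟨b, hb⟩ := S.bddAbove
    exact ⟨(b + 1).toNat, fun j hj => by have := hb hj; omega⟩
  set T : Finset ℤ := insert (-1) ((Finset.range N).map Nat.castEmbedding) with hT
  calc ∑ j ∈ S, blockSymb χ θ j z ≤ ∑ j ∈ S ∪ T, blockSymb χ θ j z :=
        Finset.sum_le_sum_of_subset_of_nonneg Finset.subset_union_left
          fun j _ _ => blockSymb_nonneg hp j z
    _ = ∑ j ∈ T, blockSymb χ θ j z := by
        refine (Finset.sum_subset Finset.subset_union_right fun j hj hjT => ?_).symm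
        have hjS : j ∈ S := (Finset.mem_union.1 hj).resolve_right hjT
        refine blockSymb_of_lt ?_ z
        by_contra hlt
        apply hjT
        rcases eq_or_ne j (-1) with rfl | hne
        · simp [hT]
        · refine Finset.mem_insert_of_mem (Finset.mem_map.2 ⟨j.toNat, ?_, ?_⟩)
          · have := hN j hjS
            simp only [Finset.mem_range]
            omega
          · simp only [Nat.castEmbedding_apply]
            omega
    _ = χ |z| + ∑ n ∈ Finset.range N, θ ((2 : ℝ) ^ (-(n : ℤ)) * |z|) := by
        rw [hT, Finset.sum_insert (by simp), Finset.sum_map, blockSymb_neg_one]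
        simp only [Nat.castEmbedding_apply, blockSymb_natCast]
    _ ≤ χ |z| + ∑' n : ℕ, θ ((2 : ℝ) ^ (-(n : ℤ)) * |z|) := by
        gcongr
        exact (summable_theta hp _).sum_le_tsum _ fun _ _ => hp.nonneg_theta _
    _ = 1 := hp.partition _

lemma summable_blockSymb (hp : IsDyadicPartition χ θ) (z : ℝ) :
    Summable fun j : ℤ => blockSymb χ θ j z :=
  summable_of_sum_le (fun j => blockSymb_nonneg hp j z) (sum_blockSymb_le_one hp z)

lemma tsum_blockSymb_le_one (hp : IsDyadicPartition χ θ) (z : ℝ) :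
    ∑' j : ℤ, blockSymb χ θ j z ≤ 1 :=
  (summable_blockSymb hp z).tsum_le_of_sum_le (sum_blockSymb_le_one hp z)

lemma blockSymb_le_one (hp : IsDyadicPartition χ θ) (j : ℤ) (z : ℝ) :
    blockSymb χ θ j z ≤ 1 := by
  simpa using sum_blockSymb_le_one hp z {j}

lemma lowSymb_nonneg (hp : IsDyadicPartition χ θ) (j : ℤ) (z : ℝ) : 0 ≤ lowSymb χ θ j z :=
  Finset.sum_nonneg fun _ _ => blockSymb_nonneg hp _ _

lemma lowSymb_le_one (hp : IsDyadicPartition χ θ) (j : ℤ) (z : ℝ) : lowSymb χ θ j z ≤ 1 :=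
  sum_blockSymb_le_one hp z _

/-- The bilinear symbol `∑_j S_{j-1}(p) Δ_j(q)` of the vertical paraproduct. -/
def paraSymb (χ θ : ℝ → ℝ) (p q : ℝ) : ℝ :=
  ∑' j : ℤ, lowSymb χ θ (j - 1) p * blockSymb χ θ j q

lemma lowSymb_mul_blockSymb_nonneg (hp : IsDyadicPartition χ θ) (p q : ℝ) (j : ℤ) :
    0 ≤ lowSymb χ θ (j - 1) p * blockSymb χ θ j q :=
  mul_nonneg (lowSymb_nonneg hp _ _) (blockSymb_nonneg hp _ _)

lemma lowSymb_mul_blockSymb_le (hp : IsDyadicPartition χ θ) (p q : ℝ) (j : ℤ) :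
    lowSymb χ θ (j - 1) p * blockSymb χ θ j q ≤ blockSymb χ θ j q :=
  mul_le_of_le_one_left (blockSymb_nonneg hp _ _) (lowSymb_le_one hp _ _)

lemma summable_lowSymb_mul_blockSymb (hp : IsDyadicPartition χ θ) (p q : ℝ) :
    Summable fun j : ℤ => lowSymb χ θ (j - 1) p * blockSymb χ θ j q :=
  (summable_blockSymb hp q).of_nonneg_of_le (lowSymb_mul_blockSymb_nonneg hp p q)
    (lowSymb_mul_blockSymb_le hp p q)

lemma paraSymb_nonneg (hp : IsDyadicPartition χ θ) (p q : ℝ) : 0 ≤ paraSymb χ θ p q :=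
  tsum_nonneg (lowSymb_mul_blockSymb_nonneg hp p q)

lemma paraSymb_le_one (hp : IsDyadicPartition χ θ) (p q : ℝ) : paraSymb χ θ p q ≤ 1 :=
  ((summable_lowSymb_mul_blockSymb hp p q).tsum_le_tsum (lowSymb_mul_blockSymb_le hp p q)
    (summable_blockSymb hp q)).trans (tsum_blockSymb_le_one hp q)

lemma two_zpow_le_of_blockSymb_ne_zero (hp : IsDyadicPartition χ θ) :
    ∃ r R : ℝ, 0 < r ∧ 0 < R ∧ ∀ j : ℤ, 0 ≤ j → ∀ z, blockSymb χ θ j z ≠ 0 →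
      r * 2 ^ j ≤ |z| ∧ |z| ≤ R * 2 ^ j := by
  obtain ⟨r, R, hr, hrR, hθ⟩ := hp.theta_support
  refine ⟨r, R, hr, hr.trans hrR, fun j hj z hz => ?_⟩
  rw [blockSymb, if_neg (by omega), if_pos hj] at hz
  have h := mt (hθ _) hz
  push Not at h
  have h2 : (0 : ℝ) < 2 ^ j := by positivity
  rw [abs_mul, abs_abs, abs_of_pos (by positivity : (0 : ℝ) < 2 ^ (-j)), zpow_neg,
    inv_mul_eq_div, le_div_iff₀ h2, div_le_iff₀ h2] at h
  exact h

/-- On the support of the paraproduct symbol the output frequency is dominated by that of the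
high-frequency factor. -/
lemma one_add_sq_le_of_paraSymb_ne_zero (hp : IsDyadicPartition χ θ) :
    ∃ K : ℝ, 0 < K ∧ ∀ p q : ℝ, paraSymb χ θ p q ≠ 0 → 1 + (p + q) ^ 2 ≤ K * (1 + q ^ 2) := by
  obtain ⟨r, R, hr, hR, hann⟩ := two_zpow_le_of_blockSymb_ne_zero hp
  obtain ⟨R₀, hR₀, hball⟩ := hp.chi_support
  set L := (R₀ + R) / r with hL
  have hL0 : 0 < L := by positivity
  refine ⟨1 + (L + 1) ^ 2, by positivity, fun p q hσ => ?_⟩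
  obtain ⟨j, hj⟩ : ∃ j : ℤ, lowSymb χ θ (j - 1) p * blockSymb χ θ j q ≠ 0 := by
    by_contra! h
    exact hσ (by simp [paraSymb, h])
  obtain ⟨j', hj', hφ⟩ := Finset.exists_ne_zero_of_sum_ne_zero (left_ne_zero_of_mul hj)
  rw [Finset.mem_Icc] at hj'
  have hq := (hann j (by omega) q (right_ne_zero_of_mul hj)).1
  have h1 : (1 : ℝ) ≤ 2 ^ j := one_le_zpow₀ (by norm_num) (by omega)
  have hp' : |p| ≤ (R₀ + R) * 2 ^ j := by
    rcases eq_or_lt_of_le hj'.1 with h | h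
    · rw [← h, blockSymb_neg_one] at hφ
      have : |p| < R₀ := by
        by_contra! hge
        exact hφ (hball _ (by simpa using hge))
      nlinarith
    · have h2 := (hann j' (by omega) p hφ).2
      have h3 : (2 : ℝ) ^ j' ≤ 2 ^ j := zpow_le_zpow_right₀ (by norm_num) (by omega)
      nlinarith
  have hpq : |p| ≤ L * |q| := by
    rw [hL, div_mul_eq_mul_div, le_div_iff₀ hr]
    nlinarith
  have hsum : |p + q| ≤ (L + 1) * |q| := (abs_add_le p q).trans (by linarith)
  have hsq : (p + q) ^ 2 ≤ (L + 1) ^ 2 * q ^ 2 := by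
    rw [← sq_abs (p + q), ← sq_abs q, ← mul_pow]
    gcongr
  nlinarith [sq_nonneg q, sq_nonneg (L + 1)]

/-- The dyadic weights resum to the inhomogeneous Sobolev weight. -/
lemma tsum_dyadic_weight_le (hp : IsDyadicPartition χ θ) {s : ℝ} (hs : 0 ≤ s) :
    ∃ K : ℝ, 0 < K ∧ ∀ z : ℝ, ∑' k : {j : ℤ // -1 ≤ j},
      ENNReal.ofReal ((2 : ℝ) ^ (2 * (k.1 : ℝ) * s)) *
        ENNReal.ofReal (blockSymb χ θ k.1 z) ^ 2 ≤ ENNReal.ofReal (K * (1 + z ^ 2) ^ s) := by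
  obtain ⟨r, R, hr, hR, hann⟩ := two_zpow_le_of_blockSymb_ne_zero hp
  set K : ℝ := 1 + (r⁻¹ ^ 2) ^ s with hK
  have hK1 : 1 ≤ K := by
    have : 0 ≤ (r⁻¹ ^ 2) ^ s := by positivity
    linarith
  refine ⟨K, by linarith, fun z => ?_⟩
  have hz1 : 1 ≤ (1 + z ^ 2) ^ s := Real.one_le_rpow (by nlinarith [sq_nonneg z]) hs
  have key : ∀ k : ℤ, -1 ≤ k → (2 : ℝ) ^ (2 * (k : ℝ) * s) * blockSymb χ θ k z ^ 2 ≤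
      K * (1 + z ^ 2) ^ s * blockSymb χ θ k z := fun k hk => by
    have hn := blockSymb_nonneg hp k z
    by_cases h0 : blockSymb χ θ k z = 0
    · simp [h0]
    have hw : (2 : ℝ) ^ (2 * (k : ℝ) * s) ≤ K * (1 + z ^ 2) ^ s := by
      rcases eq_or_lt_of_le hk with rfl | hk
      · have : (2 : ℝ) ^ (2 * ((-1 : ℤ) : ℝ) * s) ≤ 1 :=
          Real.rpow_le_one_of_one_le_of_nonpos (by norm_num) (by push_cast; linarith)
        nlinarith
      · have h1 := (hann k (by omega) z h0).1
        have h2 : ((2 : ℝ) ^ k) ^ 2 ≤ r⁻¹ ^ 2 * (1 + z ^ 2) := by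
          have h3 : (2 : ℝ) ^ k ≤ r⁻¹ * |z| := by
            rw [inv_mul_eq_div, le_div_iff₀ hr]; linarith
          calc ((2 : ℝ) ^ k) ^ 2 ≤ (r⁻¹ * |z|) ^ 2 := by gcongr
            _ = r⁻¹ ^ 2 * z ^ 2 := by rw [mul_pow, sq_abs]
            _ ≤ _ := by gcongr; linarith
        calc (2 : ℝ) ^ (2 * (k : ℝ) * s) = (((2 : ℝ) ^ k) ^ 2) ^ s := by
              rw [Real.rpow_mul (by norm_num), mul_comm, Real.rpow_mul (by norm_num),
                Real.rpow_intCast]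
              norm_num
          _ ≤ (r⁻¹ ^ 2 * (1 + z ^ 2)) ^ s := by gcongr
          _ = (r⁻¹ ^ 2) ^ s * (1 + z ^ 2) ^ s :=
              Real.mul_rpow (by positivity) (by positivity)
          _ ≤ _ := by
              gcongr
              rw [hK]; linarith
    calc _ ≤ K * (1 + z ^ 2) ^ s * blockSymb χ θ k z ^ 2 := by gcongr
      _ ≤ _ := by
        gcongr
        rw [sq]
        exact mul_le_of_le_one_left hn (blockSymb_le_one hp k z)
  have hbound : ∑' k : {j : ℤ // -1 ≤ j}, ENNReal.ofReal (blockSymb χ θ k.1 z) ≤ 1 := by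
    calc _ ≤ ∑' k : ℤ, ENNReal.ofReal (blockSymb χ θ k z) :=
          ENNReal.tsum_comp_le_tsum_of_injective Subtype.val_injective _
      _ = ENNReal.ofReal (∑' k : ℤ, blockSymb χ θ k z) :=
          (ENNReal.ofReal_tsum_of_nonneg (fun k => blockSymb_nonneg hp k z)
            (summable_blockSymb hp z)).symm
      _ ≤ 1 := by simpa using ENNReal.ofReal_le_ofReal (tsum_blockSymb_le_one hp z)
  calc _ ≤ ∑' k : {j : ℤ // -1 ≤ j}, ENNReal.ofReal (K * (1 + z ^ 2) ^ s) *
        ENNReal.ofReal (blockSymb χ θ k.1 z) := by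
        refine ENNReal.tsum_le_tsum fun k => ?_
        rw [← ENNReal.ofReal_pow (blockSymb_nonneg hp _ _), ← ENNReal.ofReal_mul (by positivity),
          ← ENNReal.ofReal_mul (by positivity)]
        exact ENNReal.ofReal_le_ofReal (key k.1 k.2)
    _ ≤ _ := by
        rw [ENNReal.tsum_mul_left]
        exact mul_le_of_le_one_right' hbound

end Symbols

/-! ### Absolutely convergent trigonometric series on the torus -/

lemma tsum_eq_tsum_tsum_equiv {α β γ : Type*} (e : β × γ ≃ α) {f : α → ℂ} (hf : Summable f) :
    ∑' a, f a = ∑' b, ∑' c, f (e (b, c)) := by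
  rw [← e.tsum_eq]
  exact Summable.tsum_prod (e.summable_iff.2 hf)

lemma norm_eK (k : ℤ × ℤ) (x : ℝ × ℝ) : ‖eK k x‖ = 1 := by
  rw [eK_eq, norm_mul, norm_ch, norm_ch, mul_one]

@[fun_prop]
lemma continuous_eK (k : ℤ × ℤ) : Continuous (eK k) := by
  have : eK k = fun x => ch k.1 x.1 * ch k.2 x.2 := funext (eK_eq k)
  rw [this]
  fun_prop

lemma eK_add (k l : ℤ × ℤ) (x : ℝ × ℝ) : eK (k + l) x = eK k x * eK l x := by
  simp only [eK_eq, Prod.fst_add, Prod.snd_add, ch_add]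
  ring

lemma fcC_eq (f : ℝ × ℝ → ℂ) (k : ℤ × ℤ) :
    fcC f k = (1 / (2 * π) ^ 2 : ℂ) * ∫ x in Q2, f x * eK (-k) x := by
  rw [fcC]
  congr with x
  rw [eK]
  congr 2
  simp only [Prod.fst_neg, Prod.snd_neg]
  push_cast
  ring

lemma integrableOn_Q2_of_continuous {E : Type*} [NormedAddCommGroup E] {f : ℝ × ℝ → E}
    (hf : Continuous f) : IntegrableOn f Q2 := by
  have hK : IsCompact (Set.Icc (0 : ℝ) (2 * π) ×ˢ Set.Icc (0 : ℝ) (2 * π)) :=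
    isCompact_Icc.prod isCompact_Icc
  exact (hf.continuousOn.integrableOn_compact hK).mono_set
    (Set.prod_mono Ioc_subset_Icc_self Ioc_subset_Icc_self)

lemma integral_eK (k : ℤ × ℤ) :
    ∫ x in Q2, eK k x = if k = 0 then ((2 * π) ^ 2 : ℂ) else 0 := by
  simp_rw [eK_eq]
  rw [Q2, Measure.volume_eq_prod, setIntegral_prod_mul, integral_ch, integral_ch]
  by_cases h1 : k.1 = 0 <;> by_cases h2 : k.2 = 0 <;> simp [h1, h2, Prod.ext_iff, sq]

lemma fcC_tsum_eK {d : ℤ × ℤ → ℂ} (hd : Summable fun k => ‖d k‖) (n : ℤ × ℤ) :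
    fcC (fun x => ∑' k, d k * eK k x) n = d n := by
  have h1 : ∀ x, (∑' k, d k * eK k x) * eK (-n) x = ∑' k, d k * eK (k - n) x := fun x => by
    rw [← tsum_mul_right]
    congr with k
    rw [sub_eq_add_neg, eK_add]
    ring
  rw [fcC_eq]
  simp_rw [h1]
  rw [← integral_tsum_of_summable_integral_norm]
  · simp_rw [integral_const_mul, integral_eK]
    rw [tsum_eq_single n]
    · have : (π : ℂ) ≠ 0 := by exact_mod_cast Real.pi_ne_zero
      simp only [sub_self, if_true]
      field_simp
    · intro k hk
      rw [if_neg (sub_ne_zero.2 hk), mul_zero]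
  · intro k
    exact integrableOn_Q2_of_continuous (by fun_prop)
  · simp only [norm_mul, norm_eK, mul_one, integral_const]
    exact hd.mul_left _

/-- Horizontal partial Fourier series: the vertical Fourier coefficient at frequency `p` of
`∑ c_k e^{ik·x}`, as a function of the horizontal variable. -/
def hSeries (c : ℤ × ℤ → ℂ) (p : ℤ) (x : ℝ) : ℂ := ∑' m : ℤ, c (m, p) * ch m x

lemma summable_hSlice {c : ℤ × ℤ → ℂ} (hc : Summable fun k => ‖c k‖) (p : ℤ) :
    Summable fun m => ‖c (m, p)‖ :=
  hc.comp_injective (i := fun m : ℤ => (m, p)) fun a b h => by simpa using h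

lemma continuous_hSeries {c : ℤ × ℤ → ℂ} (hc : Summable fun k => ‖c k‖) (p : ℤ) :
    Continuous (hSeries c p) :=
  continuous_tsum_ch (summable_hSlice hc p) fun m => m

lemma norm_hSeries_le {c : ℤ × ℤ → ℂ} (hc : Summable fun k => ‖c k‖) (p : ℤ) (x : ℝ) :
    ‖hSeries c p x‖ ≤ ∑' m, ‖c (m, p)‖ := by
  have h := norm_tsum_le_tsum_norm (summable_mul_ch (summable_hSlice hc p) (fun m => m) x)
  simpa [norm_ch, hSeries] using h

lemma summable_norm_hSeries {c : ℤ × ℤ → ℂ} (hc : Summable fun k => ‖c k‖) (x : ℝ) :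
    Summable fun p => ‖hSeries c p x‖ := by
  refine Summable.of_nonneg_of_le (fun _ => norm_nonneg _) (fun p => norm_hSeries_le hc p x) ?_
  exact ((Equiv.prodComm ℤ ℤ).summable_iff.2 hc).prod

lemma tsum_eK_eq_tsum_hSeries {c : ℤ × ℤ → ℂ} (hc : Summable fun k => ‖c k‖) (x : ℝ × ℝ) :
    ∑' k, c k * eK k x = ∑' q, hSeries c q x.1 * ch q x.2 := by
  have hs : Summable fun k => c k * eK k x := by
    refine Summable.of_norm ?_
    simpa [norm_eK] using hc
  rw [tsum_eq_tsum_tsum_equiv (Equiv.prodComm ℤ ℤ) hs]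
  congr with q
  rw [hSeries, ← tsum_mul_right]
  congr with m
  simp only [Equiv.prodComm_apply, Prod.swap_prod_mk, eK_eq]
  ring

/-! ### Fourier coefficients of the paraproduct -/

section Paraproduct

variable {χ θ : ℝ → ℝ}

/-- The double Fourier series of the paraproduct, before collecting frequencies. -/
def paraPair (χ θ : ℝ → ℝ) (G A : ℤ × ℤ → ℂ) (z : (ℤ × ℤ) × (ℤ × ℤ)) : ℂ :=
  (paraSymb χ θ z.1.2 z.2.2 : ℂ) * (G z.1 * A z.2)

/-- Fourier coefficients of the paraproduct. -/
def paraCoef (χ θ : ℝ → ℝ) (G A : ℤ × ℤ → ℂ) (n : ℤ × ℤ) : ℂ :=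
  ∑' k : ℤ × ℤ, paraPair χ θ G A (k, n - k)

lemma summable_paraPair (hp : IsDyadicPartition χ θ) {G A : ℤ × ℤ → ℂ}
    (hG : Summable fun k => ‖G k‖) (hA : Summable fun k => ‖A k‖) :
    Summable fun z => ‖paraPair χ θ G A z‖ := by
  refine Summable.of_nonneg_of_le (fun _ => norm_nonneg _) (fun z => ?_) (hG.mul_norm hA)
  rw [paraPair, norm_mul, Complex.norm_real, Real.norm_of_nonneg (paraSymb_nonneg hp _ _)]
  exact mul_le_of_le_one_left (norm_nonneg _) (paraSymb_le_one hp _ _)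

/-- The shear `(n, k) ↦ (k, n - k)`. -/
def shearEquiv (M : Type*) [AddCommGroup M] : M × M ≃ M × M where
  toFun z := (z.2, z.1 - z.2)
  invFun z := (z.1 + z.2, z.1)
  left_inv z := by simp
  right_inv z := by simp

lemma summable_paraCoef (hp : IsDyadicPartition χ θ) {G A : ℤ × ℤ → ℂ}
    (hG : Summable fun k => ‖G k‖) (hA : Summable fun k => ‖A k‖) :
    Summable fun n => ‖paraCoef χ θ G A n‖ := by
  have h := (shearEquiv (ℤ × ℤ)).summable_iff.2 (summable_paraPair hp hG hA)
  refine Summable.of_nonneg_of_le (fun _ => norm_nonneg _) (fun n => ?_) h.prod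
  exact norm_tsum_le_tsum_norm (h.prod_factor n)

lemma summable_blockSymb_mul (hp : IsDyadicPartition χ θ) {ι : Type*} {c : ι → ℂ}
    (hc : Summable fun z => ‖c z‖) (v : ι → ℝ) :
    Summable fun w : ι × ℤ => blockSymb χ θ w.2 (v w.1) * ‖c w.1‖ := by
  have h0 : ∀ w : ι × ℤ, 0 ≤ blockSymb χ θ w.2 (v w.1) * ‖c w.1‖ :=
    fun w => mul_nonneg (blockSymb_nonneg hp _ _) (norm_nonneg _)
  refine (summable_prod_of_nonneg h0).2
    ⟨fun z => (summable_blockSymb hp (v z)).mul_right ‖c z‖, ?_⟩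
  refine Summable.of_nonneg_of_le (fun z => tsum_nonneg fun j => h0 (z, j)) (fun z => ?_) hc
  simp only [tsum_mul_right]
  exact mul_le_of_le_one_left (norm_nonneg _) (tsum_blockSymb_le_one hp _)

lemma tsum_prod_para_eq (hp : IsDyadicPartition χ θ) {G A : ℤ × ℤ → ℂ}
    (hG : Summable fun k => ‖G k‖) (hA : Summable fun k => ‖A k‖) (x : ℝ × ℝ) :
    ∑' j : ℤ, (∑' k : ℤ × ℤ, (lowSymb χ θ (j - 1) k.2 : ℂ) * G k * eK k x) *
        (∑' l : ℤ × ℤ, (blockSymb χ θ j l.2 : ℂ) * A l * eK l x) =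
      ∑' n, paraCoef χ θ G A n * eK n x := by
  set f : ℤ → (ℤ × ℤ) × (ℤ × ℤ) → ℂ := fun j z =>
    ((lowSymb χ θ (j - 1) z.1.2 * blockSymb χ θ j z.2.2 : ℝ) : ℂ) *
      (G z.1 * A z.2 * eK (z.1 + z.2) x) with hf
  have hlow : ∀ j, Summable fun k : ℤ × ℤ => ‖(lowSymb χ θ (j - 1) k.2 : ℂ) * G k * eK k x‖ :=
    fun j => by
      refine Summable.of_nonneg_of_le (fun _ => norm_nonneg _) (fun k => ?_) hG
      rw [norm_mul, norm_mul, norm_eK, mul_one, Complex.norm_real,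
        Real.norm_of_nonneg (lowSymb_nonneg hp _ _)]
      exact mul_le_of_le_one_left (norm_nonneg _) (lowSymb_le_one hp _ _)
  have hblock : ∀ j, Summable fun k : ℤ × ℤ => ‖(blockSymb χ θ j k.2 : ℂ) * A k * eK k x‖ :=
    fun j => by
      refine Summable.of_nonneg_of_le (fun _ => norm_nonneg _) (fun k => ?_) hA
      rw [norm_mul, norm_mul, norm_eK, mul_one, Complex.norm_real,
        Real.norm_of_nonneg (blockSymb_nonneg hp _ _)]
      exact mul_le_of_le_one_left (norm_nonneg _) (blockSymb_le_one hp _ _)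
  have h1 : ∀ j, (∑' k : ℤ × ℤ, (lowSymb χ θ (j - 1) k.2 : ℂ) * G k * eK k x) *
      (∑' l : ℤ × ℤ, (blockSymb χ θ j l.2 : ℂ) * A l * eK l x) = ∑' z, f j z := fun j => by
    rw [tsum_mul_tsum_of_summable_norm (hlow j) (hblock j)]
    congr with z
    rw [hf]
    simp only [eK_add]
    push_cast
    ring
  have hGA : Summable fun z : (ℤ × ℤ) × (ℤ × ℤ) => ‖G z.1 * A z.2‖ := hG.mul_norm hA
  have hdom := summable_blockSymb_mul hp hGA fun z => z.2.2
  have hsum : Summable (Function.uncurry fun z j => f j z) := by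
    refine Summable.of_norm_bounded hdom fun w => ?_
    simp only [Function.uncurry, hf]
    rw [norm_mul, norm_mul _ (eK _ _), norm_eK, mul_one, Complex.norm_real,
      Real.norm_of_nonneg (lowSymb_mul_blockSymb_nonneg hp _ _ _)]
    gcongr
    exact lowSymb_mul_blockSymb_le hp _ _ _
  have h2 : ∀ z, ∑' j, f j z = paraPair χ θ G A z * eK (z.1 + z.2) x := fun z => by
    simp only [hf]
    rw [tsum_mul_right, ← Complex.ofReal_tsum, paraPair, paraSymb]
    ring
  simp_rw [h1]
  rw [hsum.tsum_comm]
  simp_rw [h2]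
  have hs : Summable fun z : (ℤ × ℤ) × (ℤ × ℤ) => paraPair χ θ G A z * eK (z.1 + z.2) x := by
    refine Summable.of_norm ?_
    simpa [norm_eK] using summable_paraPair hp hG hA
  rw [tsum_eq_tsum_tsum_equiv (shearEquiv (ℤ × ℤ)) hs]
  congr with n
  rw [paraCoef, ← tsum_mul_right]
  congr with k
  simp [shearEquiv]

lemma Tv_eq_tsum (hp : IsDyadicPartition χ θ) {g a : ℝ × ℝ → ℝ}
    (hG : Summable fun k => ‖fc g k‖) (hA : Summable fun k => ‖fc a k‖) :
    Tv χ θ g a = fun x => ∑' n, paraCoef χ θ (fc g) (fc a) n * eK n x :=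
  funext fun x => tsum_prod_para_eq hp hG hA x

lemma LPC_Tv_eq (hp : IsDyadicPartition χ θ) {g a : ℝ × ℝ → ℝ}
    (hG : Summable fun k => ‖fc g k‖) (hA : Summable fun k => ‖fc a k‖) (j : ℤ) (x : ℝ × ℝ) :
    LPC χ θ j (Tv χ θ g a) x = ∑' q : ℤ, (blockSymb χ θ j q : ℂ) *
      hSeries (paraCoef χ θ (fc g) (fc a)) q x.1 * ch q x.2 := by
  have hT := summable_paraCoef hp hG hA
  have hT' : Summable fun k : ℤ × ℤ =>
      ‖(blockSymb χ θ j k.2 : ℂ) * paraCoef χ θ (fc g) (fc a) k‖ := by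
    refine Summable.of_nonneg_of_le (fun _ => norm_nonneg _) (fun k => ?_) hT
    rw [norm_mul, Complex.norm_real, Real.norm_of_nonneg (blockSymb_nonneg hp _ _)]
    exact mul_le_of_le_one_left (norm_nonneg _) (blockSymb_le_one hp _ _)
  rw [LPC, Tv_eq_tsum hp hG hA]
  simp_rw [fcC_tsum_eK hT]
  rw [tsum_eK_eq_tsum_hSeries hT']
  congr with q
  congr 1
  simp_rw [hSeries, mul_assoc]
  rw [tsum_mul_left]

lemma hSeries_paraCoef (hp : IsDyadicPartition χ θ) {G A : ℤ × ℤ → ℂ}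
    (hG : Summable fun k => ‖G k‖) (hA : Summable fun k => ‖A k‖) (q : ℤ) (x : ℝ) :
    hSeries (paraCoef χ θ G A) q x = ∑' p : ℤ, (paraSymb χ θ p (q - p : ℤ) : ℂ) *
      (hSeries G p x * hSeries A (q - p) x) := by
  set F : ℤ × (ℤ × ℤ) → ℂ := fun w =>
    paraPair χ θ G A (w.2, (w.1, q) - w.2) * ch w.1 x with hF
  have hFs : Summable F := by
    refine Summable.of_norm ?_
    have h := (summable_paraPair hp hG hA).comp_injective
      (i := fun w : ℤ × (ℤ × ℤ) => (w.2, (w.1, q) - w.2)) (fun v w h => by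
        simp only [Prod.mk.injEq] at h
        obtain ⟨h1, h2⟩ := h
        rw [h1, sub_left_inj, Prod.mk.injEq] at h2
        exact Prod.ext h2.1 h1)
    simpa [hF, norm_ch, Function.comp_def] using h
  let e : ℤ × (ℤ × ℤ) ≃ ℤ × (ℤ × ℤ) :=
    { toFun := fun w => (w.2.1 + w.2.2, (w.2.1, w.1))
      invFun := fun w => (w.2.2, (w.2.1, w.1 - w.2.1))
      left_inv := fun w => by simp
      right_inv := fun w => by simp }
  have h1 : hSeries (paraCoef χ θ G A) q x = ∑' w, F w := by
    rw [hFs.tsum_prod, hSeries]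
    congr with m
    rw [paraCoef, ← tsum_mul_right]
  rw [h1, tsum_eq_tsum_tsum_equiv e hFs]
  congr with p
  rw [hSeries, hSeries, tsum_mul_tsum_of_summable_norm
    (summable_mul_ch (summable_hSlice hG p) (fun m => m) x)
    (summable_mul_ch (summable_hSlice hA (q - p)) (fun m => m) x), ← tsum_mul_left]
  congr with z
  simp only [e, hF, paraPair, Equiv.coe_fn_mk, ch_add, Prod.mk_sub_mk, add_sub_cancel_left]
  ring

end Paraproduct

/-! ### Decay of the Fourier coefficients of smooth periodic functions -/

section Decay

lemma fc_eq (f : ℝ × ℝ → ℝ) (k : ℤ × ℤ) :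
    fc f k = (1 / (2 * π) ^ 2 : ℂ) * ∫ x in Q2, (f x : ℂ) * eK (-k) x :=
  fcC_eq _ _

lemma fc_swap (f : ℝ × ℝ → ℝ) (k : ℤ × ℤ) : fc (fun x => f x.swap) k = fc f k.swap := by
  have h := setIntegral_prod_swap (μ := (volume : Measure ℝ)) (ν := (volume : Measure ℝ))
    I2pi I2pi fun x => (f x : ℂ) * eK (-k.swap) x
  rw [fc_eq, fc_eq, Q2, Measure.volume_eq_prod, ← h]
  congr with x
  simp only [eK_eq, Prod.fst_neg, Prod.snd_neg, Prod.fst_swap, Prod.snd_swap]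
  ring

lemma Smooth.swap {f : ℝ × ℝ → ℝ} (hf : Smooth f) : Smooth fun x => f x.swap :=
  ContDiff.comp (g := f) hf (contDiff_snd.prodMk contDiff_fst)

lemma Per.swap {f : ℝ × ℝ → ℝ} (hf : Per f) : Per fun x => f x.swap :=
  ⟨fun x => hf.2 x.swap, fun x => hf.1 x.swap⟩

lemma Smooth.pd2 {f : ℝ × ℝ → ℝ} (hf : Smooth f) : Smooth (pd2 f) := by
  have h : ContDiff ℝ (⊤ : ℕ∞) (fderiv ℝ f) := ContDiff.fderiv_right hf (by simp)
  exact h.clm_apply contDiff_const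

lemma Per.pd2 {f : ℝ × ℝ → ℝ} (hf : Per f) : Per (pd2 f) := by
  have h : ∀ v : ℝ × ℝ, (∀ x, f (x + v) = f x) → ∀ x, Aniso.pd2 f (x + v) = Aniso.pd2 f x :=
    fun v hv x => by
      have h1 : (fun y => f (y + v)) = f := funext hv
      rw [Aniso.pd2, Aniso.pd2, ← fderiv_comp_add_right, h1]
  refine ⟨fun x => ?_, fun x => ?_⟩
  · have := h (2 * π, 0) (fun x => by simpa [Prod.add_def] using hf.1 x) x
    simpa [Prod.add_def] using this
  · have := h (0, 2 * π) (fun x => by simpa [Prod.add_def] using hf.2 x) x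
    simpa [Prod.add_def] using this

lemma hasDerivAt_pd2 {f : ℝ × ℝ → ℝ} (hf : Smooth f) (x y : ℝ) :
    HasDerivAt (fun y => f (x, y)) (pd2 f (x, y)) y := by
  have h1 : HasFDerivAt f (fderiv ℝ f (x, y)) (x, y) :=
    (ContDiff.differentiable hf (by simp) (x, y)).hasFDerivAt
  have h2 : HasDerivAt (fun y : ℝ => (x, y)) ((0 : ℝ), (1 : ℝ)) y :=
    (hasDerivAt_const y x).prodMk (hasDerivAt_id y)
  exact h1.comp_hasDerivAt y h2

lemma hasDerivAt_ch (n : ℤ) (x : ℝ) : HasDerivAt (ch n) (Complex.I * n * ch n x) x := by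
  have h1 : HasDerivAt (fun x : ℝ => Complex.I * ((n : ℂ) * (x : ℂ))) (Complex.I * n) x := by
    simpa using ((Complex.ofRealCLM.hasDerivAt (x := x)).const_mul (n : ℂ)).const_mul Complex.I
  have := h1.cexp
  rwa [mul_comm] at this

lemma ch_two_pi (n : ℤ) : ch n (2 * π) = 1 := by
  rw [ch, ← Complex.exp_int_mul_two_pi_mul_I n]
  congr 1
  push_cast
  ring

lemma integral_pd2_mul_ch {f : ℝ × ℝ → ℝ} (hf : Smooth f) (hP : Per f) (x : ℝ) (n : ℤ) :
    ∫ y in I2pi, (pd2 f (x, y) : ℂ) * ch (-n) y =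
      Complex.I * n * ∫ y in I2pi, (f (x, y) : ℂ) * ch (-n) y := by
  have hc : Continuous f := ContDiff.continuous hf
  have hc2 : Continuous (pd2 f) := ContDiff.continuous hf.pd2
  have h := intervalIntegral.integral_mul_deriv_eq_deriv_mul (a := 0) (b := 2 * π)
    (u := ch (-n)) (v := fun y => (f (x, y) : ℂ))
    (u' := fun y => Complex.I * ((-n : ℤ) : ℂ) * ch (-n) y) (v' := fun y => (pd2 f (x, y) : ℂ))
    (fun y _ => hasDerivAt_ch _ y) (fun y _ => (hasDerivAt_pd2 hf x y).ofReal_comp)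
    (Continuous.intervalIntegrable (by fun_prop) _ _)
    (Continuous.intervalIntegrable (by fun_prop) _ _)
  have hper : f (x, 2 * π) = f (x, 0) := by simpa using hP.2 (x, 0)
  have h0 : ch (-n) 0 = 1 := by simp [ch]
  rw [hper, ch_two_pi, h0, sub_self, zero_sub] at h
  rw [I2pi, ← intervalIntegral.integral_of_le two_pi_nonneg,
    ← intervalIntegral.integral_of_le two_pi_nonneg]
  simp_rw [mul_comm _ (ch (-n) _)]
  rw [h, ← intervalIntegral.integral_const_mul, ← intervalIntegral.integral_neg]
  congr with y
  push_cast
  ring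

lemma integral_Q2_mul_eK {f : ℝ × ℝ → ℝ} (hf : Continuous f) (k : ℤ × ℤ) :
    ∫ x in Q2, (f x : ℂ) * eK (-k) x =
      ∫ x in I2pi, ch (-k.1) x * ∫ y in I2pi, (f (x, y) : ℂ) * ch (-k.2) y := by
  rw [Q2, Measure.volume_eq_prod, setIntegral_prod]
  · congr with x
    rw [← integral_const_mul]
    congr with y
    simp only [eK_eq, Prod.fst_neg, Prod.snd_neg]
    ring
  · exact integrableOn_Q2_of_continuous (by fun_prop)

lemma fc_pd2 {f : ℝ × ℝ → ℝ} (hf : Smooth f) (hP : Per f) (k : ℤ × ℤ) :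
    fc (pd2 f) k = Complex.I * k.2 * fc f k := by
  rw [fc_eq, fc_eq, integral_Q2_mul_eK (ContDiff.continuous hf.pd2),
    integral_Q2_mul_eK (ContDiff.continuous hf)]
  simp_rw [integral_pd2_mul_ch hf hP]
  rw [mul_left_comm, ← integral_const_mul (Complex.I * (k.2 : ℂ))]
  congr 2 with x
  ring

lemma exists_fc_eq_vertical {f : ℝ × ℝ → ℝ} (hf : Smooth f) (hP : Per f) :
    ∃ h, Smooth h ∧ Per h ∧ ∀ k, fc h k = (1 + (k.2 : ℝ) ^ 2 : ℝ) * fc f k := by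
  refine ⟨fun x => f x - pd2 (pd2 f) x, ContDiff.sub hf hf.pd2.pd2, ⟨fun x => ?_, fun x => ?_⟩,
    fun k => ?_⟩
  · simp only [hP.1 x, hP.pd2.pd2.1 x]
  · simp only [hP.2 x, hP.pd2.pd2.2 x]
  · have hc : Continuous f := ContDiff.continuous hf
    have hc2 : Continuous (pd2 (pd2 f)) := ContDiff.continuous hf.pd2.pd2
    have : fc (fun x => f x - pd2 (pd2 f) x) k = fc f k - fc (pd2 (pd2 f)) k := by
      rw [fc_eq, fc_eq, fc_eq, ← mul_sub, ← integral_sub]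
      · congr with x
        push_cast
        ring
      · exact integrableOn_Q2_of_continuous (by fun_prop)
      · exact integrableOn_Q2_of_continuous (by fun_prop)
    rw [this, fc_pd2 hf.pd2 hP.pd2, fc_pd2 hf hP]
    push_cast
    linear_combination (-(k.2 : ℂ) ^ 2 * fc f k) * Complex.I_sq

lemma exists_fc_eq_horizontal {f : ℝ × ℝ → ℝ} (hf : Smooth f) (hP : Per f) :
    ∃ h, Smooth h ∧ Per h ∧ ∀ k, fc h k = (1 + (k.1 : ℝ) ^ 2 : ℝ) * fc f k := by
  obtain ⟨h, hh, hhP, hk⟩ := exists_fc_eq_vertical hf.swap hP.swap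
  refine ⟨fun x => h x.swap, hh.swap, hhP.swap, fun k => ?_⟩
  rw [fc_swap, hk, fc_swap]
  simp

lemma exists_fc_eq_pow {f : ℝ × ℝ → ℝ} (hf : Smooth f) (hP : Per f) (N : ℕ) :
    ∃ h, Smooth h ∧ Per h ∧ ∀ k, fc h k =
      (((1 + (k.1 : ℝ) ^ 2) ^ N * (1 + (k.2 : ℝ) ^ 2) ^ N : ℝ) : ℂ) * fc f k := by
  induction N with
  | zero => exact ⟨f, hf, hP, fun k => by simp⟩
  | succ N ih =>
    obtain ⟨h, hh, hhP, hk⟩ := ih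
    obtain ⟨h₁, hh₁, hhP₁, hk₁⟩ := exists_fc_eq_vertical hh hhP
    obtain ⟨h₂, hh₂, hhP₂, hk₂⟩ := exists_fc_eq_horizontal hh₁ hhP₁
    refine ⟨h₂, hh₂, hhP₂, fun k => ?_⟩
    rw [hk₂, hk₁, hk]
    push_cast
    ring

lemma norm_fc_le (f : ℝ × ℝ → ℝ) (k : ℤ × ℤ) :
    ‖fc f k‖ ≤ ‖(1 / (2 * π) ^ 2 : ℂ)‖ * ∫ x in Q2, ‖f x‖ := by
  rw [fc_eq, norm_mul]
  gcongr
  refine (norm_integral_le_integral_norm _).trans_eq ?_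
  simp [norm_eK]

lemma exists_norm_fc_le {f : ℝ × ℝ → ℝ} (hf : Smooth f) (hP : Per f) (N : ℕ) :
    ∃ B : ℝ, 0 ≤ B ∧ ∀ k : ℤ × ℤ,
      ‖fc f k‖ ≤ B * (((1 + (k.1 : ℝ) ^ 2) ^ N)⁻¹ * ((1 + (k.2 : ℝ) ^ 2) ^ N)⁻¹) := by
  obtain ⟨h, -, -, hk⟩ := exists_fc_eq_pow hf hP N
  refine ⟨‖(1 / (2 * π) ^ 2 : ℂ)‖ * ∫ x in Q2, ‖h x‖,
    mul_nonneg (norm_nonneg _) (integral_nonneg fun _ => norm_nonneg _), fun k => ?_⟩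
  have h1 := norm_fc_le h k
  rw [hk, norm_mul, Complex.norm_real, Real.norm_of_nonneg (by positivity)] at h1
  rw [← mul_inv, ← div_eq_mul_inv, le_div_iff₀ (by positivity)]
  linarith

lemma summable_one_add_sq_rpow {b : ℝ} (hb : 1 / 2 < b) :
    Summable fun n : ℤ => (1 + (n : ℝ) ^ 2) ^ (-b) := by
  have h1 := (Real.summable_abs_int_rpow (b := 2 * b) (by linarith))
  have h2 : Summable fun n : ℤ => if n = 0 then (1 : ℝ) else 0 :=
    summable_of_ne_finset_zero (s := {0}) fun n hn => by simpa using hn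
  refine Summable.of_nonneg_of_le (fun n => by positivity) (fun n => ?_) (h1.add h2)
  by_cases hn : n = 0
  · subst hn
    have : (0 : ℝ) ^ (-(2 * b)) = 0 := Real.zero_rpow (by linarith)
    simp [this]
  · have hn' : 0 < |(n : ℝ)| := by positivity
    rw [if_neg hn, add_zero, show -(2 * b) = 2 * -b by ring, Real.rpow_mul hn'.le]
    refine Real.rpow_le_rpow_of_nonpos (by positivity) ?_ (by linarith)
    rw [Real.rpow_two, sq_abs]
    linarith

lemma summable_one_add_sq_inv : Summable fun n : ℤ => (1 + (n : ℝ) ^ 2)⁻¹ := by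
  simpa [Real.rpow_neg_one] using summable_one_add_sq_rpow (b := 1) (by norm_num)

lemma summable_one_add_sq_inv_prod :
    Summable fun k : ℤ × ℤ => (1 + (k.1 : ℝ) ^ 2)⁻¹ * (1 + (k.2 : ℝ) ^ 2)⁻¹ :=
  summable_one_add_sq_inv.mul_of_nonneg summable_one_add_sq_inv (fun _ => by positivity)
    fun _ => by positivity

lemma summable_norm_fc {f : ℝ × ℝ → ℝ} (hf : Smooth f) (hP : Per f) :
    Summable fun k => ‖fc f k‖ := by
  obtain ⟨B, -, hB⟩ := exists_norm_fc_le hf hP 1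
  refine Summable.of_nonneg_of_le (fun _ => norm_nonneg _) (fun k => ?_)
    (summable_one_add_sq_inv_prod.mul_left B)
  simpa using hB k

lemma summable_aw_mul_sq {f : ℝ × ℝ → ℝ} (hf : Smooth f) (hP : Per f) (s s' : ℝ) :
    Summable fun k => aw s s' k * ‖fc f k‖ ^ 2 := by
  obtain ⟨N, hN⟩ := exists_nat_ge (max s s')
  obtain ⟨B, hB0, hB⟩ := exists_norm_fc_le hf hP (N + 1)
  refine Summable.of_nonneg_of_le (fun k => by unfold aw; positivity) (fun k => ?_)
    (summable_one_add_sq_inv_prod.mul_left (B ^ 2))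
  have hx : (1 : ℝ) ≤ 1 + (k.1 : ℝ) ^ 2 := by nlinarith [sq_nonneg (k.1 : ℝ)]
  have hy : (1 : ℝ) ≤ 1 + (k.2 : ℝ) ^ 2 := by nlinarith [sq_nonneg (k.2 : ℝ)]
  have hpow : ∀ {t x : ℝ}, t ≤ max s s' → 1 ≤ x → x ^ t * (x ^ (N + 1))⁻¹ ^ 2 ≤ x⁻¹ :=
    fun {t x} ht hx => by
      have hx0 : 0 < x := by linarith
      have h1 : x ^ t ≤ x ^ N := by
        rw [← Real.rpow_natCast]
        exact Real.rpow_le_rpow_of_exponent_le hx (ht.trans hN)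
      have h2 : (x ^ (N + 1))⁻¹ ≤ 1 := inv_le_one_of_one_le₀ (one_le_pow₀ hx)
      calc x ^ t * (x ^ (N + 1))⁻¹ ^ 2 ≤ x ^ N * ((x ^ (N + 1))⁻¹ * 1) := by
            rw [sq]; gcongr
        _ = x⁻¹ := by rw [pow_succ]; field_simp
  set x : ℝ := 1 + (k.1 : ℝ) ^ 2 with hxd
  set y : ℝ := 1 + (k.2 : ℝ) ^ 2 with hyd
  calc aw s s' k * ‖fc f k‖ ^ 2
      ≤ (x ^ s * y ^ s') * (B * ((x ^ (N + 1))⁻¹ * (y ^ (N + 1))⁻¹)) ^ 2 := by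
        rw [aw]
        gcongr
        exact hB k
    _ = B ^ 2 * ((x ^ s * (x ^ (N + 1))⁻¹ ^ 2) * (y ^ s' * (y ^ (N + 1))⁻¹ ^ 2)) := by ring
    _ ≤ B ^ 2 * (x⁻¹ * y⁻¹) := by
        gcongr
        · exact hpow (le_max_left _ _) hx
        · exact hpow (le_max_right _ _) hy

lemma ofReal_HSq {f : ℝ × ℝ → ℝ} (hf : Smooth f) (hP : Per f) (s s' : ℝ) :
    ENNReal.ofReal (HSq s s' f) = ∑' k, ENNReal.ofReal (aw s s' k) * ‖fc f k‖ₑ ^ 2 := by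
  have h0 : ∀ k, 0 ≤ aw s s' k := fun k => by unfold aw; positivity
  rw [HSq, ENNReal.ofReal_tsum_of_nonneg (fun k => mul_nonneg (h0 k) (by positivity))
    (summable_aw_mul_sq hf hP s s')]
  congr with k
  rw [ENNReal.ofReal_mul (h0 k), ENNReal.ofReal_pow (norm_nonneg _), ofReal_norm]

end Decay

/-! ### The critical embedding of `H^{1/4}` into `L⁴` on the circle -/

lemma sum_Icc_one_add_sq_rpow_le (L : ℕ) :
    ∑ m ∈ Finset.Icc (-(L : ℤ)) L, (1 + (m : ℝ) ^ 2) ^ (-(1 / 4) : ℝ) ≤ 1 + 4 * √L := by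
  induction L with
  | zero => simp
  | succ L ih =>
    have hset : Finset.Icc (-((L + 1 : ℕ) : ℤ)) ((L + 1 : ℕ) : ℤ) =
        insert ((L : ℤ) + 1) (insert (-((L : ℤ) + 1)) (Finset.Icc (-(L : ℤ)) L)) := by
      ext m
      simp only [Finset.mem_Icc, Finset.mem_insert]
      push_cast
      omega
    have hterm : (1 + ((L : ℝ) + 1) ^ 2) ^ (-(1 / 4) : ℝ) ≤ 2 * (√(L + 1) - √L) := by
      have h1 : (1 + ((L : ℝ) + 1) ^ 2) ^ (-(1 / 4) : ℝ) ≤ (√((L : ℝ) + 1))⁻¹ := by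
        calc (1 + ((L : ℝ) + 1) ^ 2) ^ (-(1 / 4) : ℝ)
            ≤ (((L : ℝ) + 1) ^ 2) ^ (-(1 / 4) : ℝ) :=
              Real.rpow_le_rpow_of_nonpos (by positivity) (by linarith) (by norm_num)
          _ = (√((L : ℝ) + 1))⁻¹ := by
              rw [Real.sqrt_eq_rpow, ← Real.rpow_neg (by positivity), ← Real.rpow_natCast,
                ← Real.rpow_mul (by positivity)]
              norm_num
      refine h1.trans ?_
      have hb : 0 < √((L : ℝ) + 1) := by positivity
      have ha : 0 ≤ √(L : ℝ) := Real.sqrt_nonneg _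
      have hab : √(L : ℝ) ≤ √((L : ℝ) + 1) := Real.sqrt_le_sqrt (by linarith)
      have hb2 : √((L : ℝ) + 1) ^ 2 = L + 1 := Real.sq_sqrt (by positivity)
      have ha2 : √(L : ℝ) ^ 2 = L := Real.sq_sqrt (by positivity)
      rw [inv_le_iff_one_le_mul₀ hb]
      nlinarith
    rw [hset, Finset.sum_insert, Finset.sum_insert]
    · push_cast
      rw [neg_sq]
      linarith
    · simp only [Finset.mem_Icc]; omega
    · simp only [Finset.mem_Icc, Finset.mem_insert]; omega

lemma tsum_ite_one_add_sq_rpow_le (l : ℤ) :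
    ∑' m : ℤ, (if |m| ≤ |l| then ENNReal.ofReal ((1 + (m : ℝ) ^ 2) ^ (-(1 / 4) : ℝ)) else 0) ≤
      5 * ENNReal.ofReal ((1 + (l : ℝ) ^ 2) ^ (1 / 4 : ℝ)) := by
  have hmem : ∀ m : ℤ, m ∈ Finset.Icc (-(l.natAbs : ℤ)) l.natAbs ↔ |m| ≤ |l| := fun m => by
    rw [Finset.mem_Icc, Int.natCast_natAbs, abs_le]
  rw [tsum_eq_sum (s := Finset.Icc (-(l.natAbs : ℤ)) l.natAbs)
    fun m hm => if_neg (mt (hmem m).2 hm)]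
  rw [Finset.sum_congr rfl fun m hm => if_pos ((hmem m).1 hm),
    ← ENNReal.ofReal_sum_of_nonneg fun m _ => by positivity,
    show (5 : ENNReal) = ENNReal.ofReal 5 by simp, ← ENNReal.ofReal_mul (by norm_num)]
  refine ENNReal.ofReal_le_ofReal ((sum_Icc_one_add_sq_rpow_le _).trans ?_)
  have hcast : ((l.natAbs : ℕ) : ℝ) = |(l : ℝ)| := by simp
  have h1 : (1 : ℝ) ≤ (1 + (l : ℝ) ^ 2) ^ (1 / 4 : ℝ) :=
    Real.one_le_rpow (by nlinarith [sq_nonneg (l : ℝ)]) (by norm_num)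
  have h2 : √|(l : ℝ)| ≤ (1 + (l : ℝ) ^ 2) ^ (1 / 4 : ℝ) := by
    calc √|(l : ℝ)| = ((l : ℝ) ^ 2) ^ (1 / 4 : ℝ) := by
          rw [← sq_abs, Real.sqrt_eq_rpow, ← Real.rpow_natCast,
            ← Real.rpow_mul (by positivity)]
          norm_num
      _ ≤ _ := by gcongr; linarith
  rw [hcast]
  linarith

/-- A bilinear estimate on `ℤ`, dual to the critical embedding `H^{1/4} ⊂ L⁴`. -/
lemma tsum_self_conv_sq_le (u : ℤ → ENNReal) :
    ∑' n, (∑' m, u m * u (n - m)) ^ 2 ≤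
      20 * (∑' m : ℤ, ENNReal.ofReal ((1 + (m : ℝ) ^ 2) ^ (1 / 4 : ℝ)) * u m ^ 2) ^ 2 := by
  set S := ∑' m : ℤ, ENNReal.ofReal ((1 + (m : ℝ) ^ 2) ^ (1 / 4 : ℝ)) * u m ^ 2 with hS
  set P : ℤ → ENNReal := fun n => ∑' m, if |m| ≤ |n - m| then u m * u (n - m) else 0 with hP
  have hhalf : ∀ n, ∑' m, u m * u (n - m) ≤ 2 * P n := fun n => by
    have hrefl : ∑' m, (if |n - m| ≤ |m| then u m * u (n - m) else 0) = P n := by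
      rw [hP, ← (Equiv.subLeft n).tsum_eq]
      simp [mul_comm]
    calc ∑' m, u m * u (n - m) ≤ ∑' m, ((if |m| ≤ |n - m| then u m * u (n - m) else 0) +
          if |n - m| ≤ |m| then u m * u (n - m) else 0) := by
          refine ENNReal.tsum_le_tsum fun m => ?_
          rcases le_total |m| |n - m| with h | h
          · rw [if_pos h]; exact le_self_add
          · rw [if_pos h]; exact le_add_self
      _ = 2 * P n := by rw [ENNReal.tsum_add, hrefl, two_mul]
  have hCS : ∀ n, P n ^ 2 ≤ S * ∑' m : ℤ, if |m| ≤ |n - m| then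
      ENNReal.ofReal ((1 + (m : ℝ) ^ 2) ^ (-(1 / 4) : ℝ)) * u (n - m) ^ 2 else 0 := fun n => by
    have h := tsum_mul_sq_le
      (fun m : ℤ => ENNReal.ofReal ((1 + (m : ℝ) ^ 2) ^ (1 / 8 : ℝ)) * u m)
      (fun m : ℤ => if |m| ≤ |n - m| then
        ENNReal.ofReal ((1 + (m : ℝ) ^ 2) ^ (-(1 / 8) : ℝ)) * u (n - m) else 0)
    have hpos : ∀ m : ℤ, (0 : ℝ) < 1 + (m : ℝ) ^ 2 := fun m => by positivity
    have e1 : ∀ m : ℤ, ENNReal.ofReal ((1 + (m : ℝ) ^ 2) ^ (1 / 8 : ℝ)) *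
        ENNReal.ofReal ((1 + (m : ℝ) ^ 2) ^ (-(1 / 8) : ℝ)) = 1 := fun m => by
      rw [← ENNReal.ofReal_mul (by positivity), ← Real.rpow_add (hpos m)]
      simp
    have e2 : ∀ (m : ℤ) (t : ℝ), ENNReal.ofReal ((1 + (m : ℝ) ^ 2) ^ t) ^ 2 =
        ENNReal.ofReal ((1 + (m : ℝ) ^ 2) ^ (t * 2)) := fun m t => by
      rw [← ENNReal.ofReal_pow (by positivity), Real.rpow_mul (hpos m).le, Real.rpow_two]
    have hl : ∀ m : ℤ, ENNReal.ofReal ((1 + (m : ℝ) ^ 2) ^ (1 / 8 : ℝ)) * u m *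
        (if |m| ≤ |n - m| then
          ENNReal.ofReal ((1 + (m : ℝ) ^ 2) ^ (-(1 / 8) : ℝ)) * u (n - m) else 0) =
        if |m| ≤ |n - m| then u m * u (n - m) else 0 := fun m => by
      split_ifs
      · rw [mul_mul_mul_comm, e1, one_mul]
      · rw [mul_zero]
    simp only [hl, mul_pow, e2, ite_pow] at h
    norm_num at h
    refine h.trans_eq ?_
    rw [hS]
  have hdouble : ∑' n : ℤ, ∑' m : ℤ, (if |m| ≤ |n - m| then
      ENNReal.ofReal ((1 + (m : ℝ) ^ 2) ^ (-(1 / 4) : ℝ)) * u (n - m) ^ 2 else 0) ≤ 5 * S := by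
    calc _ = ∑' l : ℤ, u l ^ 2 * ∑' m : ℤ, (if |m| ≤ |l| then
          ENNReal.ofReal ((1 + (m : ℝ) ^ 2) ^ (-(1 / 4) : ℝ)) else 0) := by
          rw [ENNReal.tsum_comm]
          have : ∀ m : ℤ, ∑' n : ℤ, (if |m| ≤ |n - m| then
              ENNReal.ofReal ((1 + (m : ℝ) ^ 2) ^ (-(1 / 4) : ℝ)) * u (n - m) ^ 2 else 0) =
              ∑' l : ℤ, u l ^ 2 * (if |m| ≤ |l| then
                ENNReal.ofReal ((1 + (m : ℝ) ^ 2) ^ (-(1 / 4) : ℝ)) else 0) := fun m => by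
            rw [← (Equiv.subRight m).tsum_eq fun l : ℤ => u l ^ 2 * (if |m| ≤ |l| then
              ENNReal.ofReal ((1 + (m : ℝ) ^ 2) ^ (-(1 / 4) : ℝ)) else 0)]
            refine tsum_congr fun n => ?_
            rw [Equiv.subRight_apply, mul_ite, mul_zero, mul_comm]
          simp_rw [this]
          rw [ENNReal.tsum_comm]
          simp_rw [ENNReal.tsum_mul_left]
      _ ≤ ∑' l : ℤ, u l ^ 2 * (5 * ENNReal.ofReal ((1 + (l : ℝ) ^ 2) ^ (1 / 4 : ℝ))) := by
          gcongr with l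
          exact tsum_ite_one_add_sq_rpow_le l
      _ = 5 * S := by
          rw [hS, ← ENNReal.tsum_mul_left]
          congr with l
          ring
  calc ∑' n, (∑' m, u m * u (n - m)) ^ 2 ≤ ∑' n, 4 * (S * ∑' m : ℤ, if |m| ≤ |n - m| then
        ENNReal.ofReal ((1 + (m : ℝ) ^ 2) ^ (-(1 / 4) : ℝ)) * u (n - m) ^ 2 else 0) := by
        refine ENNReal.tsum_le_tsum fun n => ?_
        calc (∑' m, u m * u (n - m)) ^ 2 ≤ (2 * P n) ^ 2 := by gcongr; exact hhalf n
          _ = 4 * P n ^ 2 := by ring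
          _ ≤ _ := by gcongr; exact hCS n
    _ ≤ 4 * (S * (5 * S)) := by
        rw [ENNReal.tsum_mul_left, ENNReal.tsum_mul_left]
        gcongr
    _ = 20 * S ^ 2 := by ring

lemma lintegral_enorm_tsum_ch_four_le {c : ℤ → ℂ} (hc : Summable fun n => ‖c n‖) :
    ∫⁻ x in I2pi, (‖∑' n, c n * ch n x‖ₑ ^ 2) ^ 2 ≤
      (12 * ∑' m : ℤ, ENNReal.ofReal ((1 + (m : ℝ) ^ 2) ^ (1 / 4 : ℝ)) * ‖c m‖ₑ ^ 2) ^ 2 := by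
  set b : ℤ → ℂ := fun n => ∑' m, c m * c (n - m) with hb
  have hcc : Summable fun z : ℤ × ℤ => ‖c z.1 * c z.2‖ := hc.mul_norm hc
  have hsh := (shearEquiv ℤ).summable_iff.2 hcc
  have hbs : Summable fun n => ‖b n‖ :=
    Summable.of_nonneg_of_le (fun _ => norm_nonneg _)
      (fun n => norm_tsum_le_tsum_norm (hsh.prod_factor n)) hsh.prod
  have hsq : ∀ x, (∑' n, c n * ch n x) ^ 2 = ∑' n, b n * ch n x := fun x => by
    have hs : Summable fun z : ℤ × ℤ => c z.1 * c z.2 * ch (z.1 + z.2) x := by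
      refine Summable.of_norm ?_
      simpa only [norm_mul, norm_ch, mul_one] using hcc
    rw [sq, tsum_mul_tsum_of_summable_norm (summable_mul_ch hc (fun n => n) x)
      (summable_mul_ch hc (fun n => n) x)]
    have : ∀ z : ℤ × ℤ, c z.1 * ch z.1 x * (c z.2 * ch z.2 x) =
        c z.1 * c z.2 * ch (z.1 + z.2) x := fun z => by rw [ch_add]; ring
    simp_rw [this]
    rw [tsum_eq_tsum_tsum_equiv (shearEquiv ℤ) hs]
    congr with n
    rw [hb, ← tsum_mul_right]
    simp [shearEquiv]
  calc ∫⁻ x in I2pi, (‖∑' n, c n * ch n x‖ₑ ^ 2) ^ 2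
      = ∫⁻ x in I2pi, ‖∑' n, b n * ch n x‖ₑ ^ 2 := by
        simp_rw [← hsq, ← enorm_pow]
    _ = ENNReal.ofReal (2 * π) * ∑' n, ‖b n‖ₑ ^ 2 := lintegral_enorm_tsum_ch_sq hbs
    _ ≤ ENNReal.ofReal (2 * π) * ∑' n, (∑' m, ‖c m‖ₑ * ‖c (n - m)‖ₑ) ^ 2 := by
        gcongr with n
        refine (enorm_tsum_le _).trans_eq ?_
        simp_rw [enorm_mul]
    _ ≤ ENNReal.ofReal (36 / 5) * (20 *
        (∑' m : ℤ, ENNReal.ofReal ((1 + (m : ℝ) ^ 2) ^ (1 / 4 : ℝ)) * ‖c m‖ₑ ^ 2) ^ 2) := by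
        gcongr
        · linarith [Real.pi_lt_d2]
        · exact tsum_self_conv_sq_le _
    _ = _ := by
        rw [← mul_assoc, mul_pow, show (20 : ENNReal) = ENNReal.ofReal 20 by simp,
          show (12 : ENNReal) = ENNReal.ofReal 12 by simp, ← ENNReal.ofReal_mul (by norm_num),
          ← ENNReal.ofReal_pow (by norm_num)]
        norm_num

/-! ### The paraproduct estimate in terms of Fourier coefficients -/

lemma tsum_prod_swap (f : ℤ × ℤ → ENNReal) : ∑' k, f k = ∑' q, ∑' m, f (m, q) := by
  rw [← (Equiv.prodComm ℤ ℤ).tsum_eq]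
  exact ENNReal.tsum_prod (f := fun q m => f (m, q))

/-- The `H^s` energy of the vertical Fourier coefficients at a fixed horizontal position. -/
def vertSq (s : ℝ) (c : ℤ × ℤ → ℂ) (x : ℝ) : ENNReal :=
  ∑' q : ℤ, ENNReal.ofReal ((1 + (q : ℝ) ^ 2) ^ s) * ‖hSeries c q x‖ₑ ^ 2

lemma measurable_vertSq (s : ℝ) {c : ℤ × ℤ → ℂ} (hc : Summable fun k => ‖c k‖) :
    Measurable (vertSq s c) :=
  Measurable.tsum fun q =>
    ((continuous_hSeries hc q).measurable.enorm.pow_const 2).const_mul _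

lemma lintegral_vertSq (s : ℝ) {c : ℤ × ℤ → ℂ} (hc : Summable fun k => ‖c k‖) :
    ∫⁻ x in I2pi, vertSq s c x =
      ENNReal.ofReal (2 * π) * ∑' k, ENNReal.ofReal (aw 0 s k) * ‖c k‖ₑ ^ 2 := by
  have hm : ∀ q, Measurable fun x => ‖hSeries c q x‖ₑ ^ 2 := fun q =>
    (continuous_hSeries hc q).measurable.enorm.pow_const 2
  unfold vertSq
  rw [lintegral_tsum fun q => ((hm q).const_mul _).aemeasurable,
    tsum_prod_swap, ← ENNReal.tsum_mul_left]
  refine tsum_congr fun q => ?_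
  rw [lintegral_const_mul _ (hm q)]
  unfold hSeries
  rw [lintegral_enorm_tsum_ch_sq (summable_hSlice hc q)]
  simp [aw, ENNReal.tsum_mul_left]
  ring

lemma lintegral_vertSq_sq_le (s : ℝ) {c : ℤ × ℤ → ℂ} (hc : Summable fun k => ‖c k‖) :
    ∫⁻ x in I2pi, vertSq s c x ^ 2 ≤
      (12 * ∑' k, ENNReal.ofReal (aw (1 / 4) s k) * ‖c k‖ₑ ^ 2) ^ 2 := by
  have hm : ∀ q, Measurable fun x => ‖hSeries c q x‖ₑ ^ 2 := fun q =>
    (continuous_hSeries hc q).measurable.enorm.pow_const 2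
  have hsum : 12 * ∑' k, ENNReal.ofReal (aw (1 / 4) s k) * ‖c k‖ₑ ^ 2 =
      ∑' q : ℤ, ENNReal.ofReal ((1 + (q : ℝ) ^ 2) ^ s) *
        (12 * ∑' m : ℤ, ENNReal.ofReal ((1 + (m : ℝ) ^ 2) ^ (1 / 4 : ℝ)) * ‖c (m, q)‖ₑ ^ 2) := by
    rw [tsum_prod_swap, ← ENNReal.tsum_mul_left]
    refine tsum_congr fun q => ?_
    rw [← ENNReal.tsum_mul_left, ← ENNReal.tsum_mul_left, ← ENNReal.tsum_mul_left]
    refine tsum_congr fun m => ?_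
    rw [aw, ENNReal.ofReal_mul (by positivity)]
    ring
  rw [hsum]
  refine lintegral_tsum_sq_le (fun q => (hm q).const_mul _) fun q => ?_
  simp_rw [mul_pow (ENNReal.ofReal _)]
  rw [lintegral_const_mul _ ((hm q).pow_const 2)]
  gcongr
  exact lintegral_enorm_tsum_ch_four_le (summable_hSlice hc q)

lemma tsum_enorm_hSeries_sq_le (b : ℝ) (c : ℤ × ℤ → ℂ) (x : ℝ) :
    (∑' p, ‖hSeries c p x‖ₑ) ^ 2 ≤
      (∑' p : ℤ, ENNReal.ofReal ((1 + (p : ℝ) ^ 2) ^ (-b))) * vertSq b c x := by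
  have hpos : ∀ p : ℤ, (0 : ℝ) < 1 + (p : ℝ) ^ 2 := fun p => by positivity
  have hsq : ∀ (p : ℤ) (t : ℝ), ENNReal.ofReal ((1 + (p : ℝ) ^ 2) ^ (t / 2)) ^ 2 =
      ENNReal.ofReal ((1 + (p : ℝ) ^ 2) ^ t) := fun p t => by
    rw [← ENNReal.ofReal_pow (by positivity), ← Real.rpow_two, ← Real.rpow_mul (hpos p).le,
      div_mul_cancel₀ _ (by norm_num)]
  have h := tsum_mul_sq_le (fun p : ℤ => ENNReal.ofReal ((1 + (p : ℝ) ^ 2) ^ (-b / 2)))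
    (fun p : ℤ => ENNReal.ofReal ((1 + (p : ℝ) ^ 2) ^ (b / 2)) * ‖hSeries c p x‖ₑ)
  simp_rw [mul_pow, hsq] at h
  rw [← vertSq] at h
  convert h using 3
  funext p
  rw [← mul_assoc, ← ENNReal.ofReal_mul (by positivity), ← Real.rpow_add (hpos p)]
  simp [neg_div]

lemma vertSq_paraCoef_le {χ θ : ℝ → ℝ} (hp : IsDyadicPartition χ θ) {s : ℝ} (hs : 0 ≤ s) :
    ∃ K : ℝ, 0 < K ∧ ∀ G A : ℤ × ℤ → ℂ, (Summable fun k => ‖G k‖) → (Summable fun k => ‖A k‖) →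
      ∀ x, vertSq s (paraCoef χ θ G A) x ≤
        ENNReal.ofReal K * (∑' p, ‖hSeries G p x‖ₑ) ^ 2 * vertSq s A x := by
  obtain ⟨K, hK, hsupp⟩ := one_add_sq_le_of_paraSymb_ne_zero hp
  refine ⟨K ^ s, by positivity, fun G A hG hA x => ?_⟩
  have hpos : ∀ p : ℤ, (0 : ℝ) < 1 + (p : ℝ) ^ 2 := fun p => by positivity
  set v : ℤ → ENNReal := fun q => ENNReal.ofReal ((1 + (q : ℝ) ^ 2) ^ (s / 2)) with hv
  have hvsq : ∀ q, v q ^ 2 = ENNReal.ofReal ((1 + (q : ℝ) ^ 2) ^ s) := fun q => by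
    rw [hv, ← ENNReal.ofReal_pow (by positivity), ← Real.rpow_two, ← Real.rpow_mul (hpos q).le,
      div_mul_cancel₀ _ (by norm_num)]
  have hKsq : ENNReal.ofReal (K ^ (s / 2)) ^ 2 = ENNReal.ofReal (K ^ s) := by
    rw [← ENNReal.ofReal_pow (by positivity), ← Real.rpow_two, ← Real.rpow_mul hK.le,
      div_mul_cancel₀ _ (by norm_num)]
  have hterm : ∀ q p : ℤ, v q * ‖(paraSymb χ θ p (q - p : ℤ) : ℂ)‖ₑ ≤
      ENNReal.ofReal (K ^ (s / 2)) * v (q - p) := fun q p => by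
    by_cases h0 : paraSymb χ θ p (q - p : ℤ) = 0
    · rw [h0]
      simp
    have h1 : ‖(paraSymb χ θ p (q - p : ℤ) : ℂ)‖ₑ ≤ 1 := by
      rw [← ofReal_norm, Complex.norm_real, Real.norm_of_nonneg (paraSymb_nonneg hp _ _)]
      exact ENNReal.ofReal_le_one.2 (paraSymb_le_one hp _ _)
    have h2 := hsupp _ _ h0
    rw [show (p : ℝ) + ((q - p : ℤ) : ℝ) = q by push_cast; ring] at h2
    calc v q * ‖(paraSymb χ θ p (q - p : ℤ) : ℂ)‖ₑ ≤ v q * 1 := by gcongr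
      _ ≤ ENNReal.ofReal (K ^ (s / 2)) * v (q - p) := by
        rw [mul_one, hv, ← ENNReal.ofReal_mul (by positivity),
          ← Real.mul_rpow hK.le (hpos _).le]
        exact ENNReal.ofReal_le_ofReal (Real.rpow_le_rpow (hpos q).le h2 (by positivity))
  have hconv : ∀ q, v q * ‖hSeries (paraCoef χ θ G A) q x‖ₑ ≤ ENNReal.ofReal (K ^ (s / 2)) *
      ∑' p, ‖hSeries G p x‖ₑ * (v (q - p) * ‖hSeries A (q - p) x‖ₑ) := fun q => by
    rw [hSeries_paraCoef hp hG hA, ← ENNReal.tsum_mul_left]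
    refine (mul_le_mul_right (enorm_tsum_le _) _).trans ?_
    rw [← ENNReal.tsum_mul_left]
    refine ENNReal.tsum_le_tsum fun p => ?_
    rw [enorm_mul, enorm_mul, ← mul_assoc]
    refine (mul_le_mul_left (hterm q p) _).trans_eq ?_
    ring
  calc vertSq s (paraCoef χ θ G A) x
      = ∑' q, (v q * ‖hSeries (paraCoef χ θ G A) q x‖ₑ) ^ 2 := by
        simp_rw [mul_pow, hvsq, vertSq]
    _ ≤ ∑' q, (ENNReal.ofReal (K ^ (s / 2)) *
          ∑' p, ‖hSeries G p x‖ₑ * (v (q - p) * ‖hSeries A (q - p) x‖ₑ)) ^ 2 := by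
        exact ENNReal.tsum_le_tsum fun q => pow_le_pow_left' (hconv q) 2
    _ ≤ ENNReal.ofReal (K ^ s) * ((∑' p, ‖hSeries G p x‖ₑ) ^ 2 *
          ∑' q, (v q * ‖hSeries A q x‖ₑ) ^ 2) := by
        simp_rw [mul_pow (ENNReal.ofReal (K ^ (s / 2))), hKsq]
        rw [ENNReal.tsum_mul_left]
        gcongr
        exact tsum_conv_sq_le (fun p => ‖hSeries G p x‖ₑ) fun q => v q * ‖hSeries A q x‖ₑ
    _ = _ := by
        simp_rw [mul_pow, hvsq, vertSq, mul_assoc]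

/-- The vertical block `Δ_j` of the function with Fourier coefficients `c`. -/
def blockSeries (χ θ : ℝ → ℝ) (c : ℤ × ℤ → ℂ) (j : ℤ) (x y : ℝ) : ℂ :=
  ∑' q : ℤ, (blockSymb χ θ j q : ℂ) * hSeries c q x * ch q y

lemma measurable_blockSeries {χ θ : ℝ → ℝ} (hp : IsDyadicPartition χ θ) {c : ℤ × ℤ → ℂ}
    (hc : Summable fun k => ‖c k‖) (j : ℤ) :
    Measurable fun z : ℝ × ℝ => blockSeries χ θ c j z.1 z.2 := by
  have hd : Summable fun q : ℤ => ∑' m, ‖c (m, q)‖ :=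
    ((Equiv.prodComm ℤ ℤ).summable_iff.2 hc).prod
  refine (continuous_tsum (fun q => ?_) hd fun q z => ?_).measurable
  · have := continuous_hSeries hc q
    fun_prop
  · rw [norm_mul, norm_mul, norm_ch, mul_one, Complex.norm_real,
      Real.norm_of_nonneg (blockSymb_nonneg hp _ _)]
    exact (mul_le_of_le_one_left (norm_nonneg _) (blockSymb_le_one hp _ _)).trans
      (norm_hSeries_le hc q _)

lemma tsum_lintegral_blockSeries_sq_le {χ θ : ℝ → ℝ} (hp : IsDyadicPartition χ θ) {s : ℝ}
    (hs : 0 ≤ s) :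
    ∃ K : ℝ, 0 < K ∧ ∀ c : ℤ × ℤ → ℂ, (Summable fun k => ‖c k‖) → ∀ x,
      ∑' k : {j : ℤ // -1 ≤ j}, ENNReal.ofReal ((2 : ℝ) ^ (2 * (k.1 : ℝ) * s)) *
        ∫⁻ y in I2pi, ‖blockSeries χ θ c k.1 x y‖ₑ ^ 2 ≤ ENNReal.ofReal K * vertSq s c x := by
  obtain ⟨K, hK, hw⟩ := tsum_dyadic_weight_le hp hs
  refine ⟨2 * π * K, by positivity, fun c hc x => ?_⟩
  have hpars : ∀ j : ℤ, ∫⁻ y in I2pi, ‖blockSeries χ θ c j x y‖ₑ ^ 2 =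
      ENNReal.ofReal (2 * π) * ∑' q : ℤ,
        ENNReal.ofReal (blockSymb χ θ j q) ^ 2 * ‖hSeries c q x‖ₑ ^ 2 := fun j => by
    have hb : ∀ q : ℤ, ‖(blockSymb χ θ j q : ℂ)‖ = blockSymb χ θ j q := fun q => by
      rw [Complex.norm_real, Real.norm_of_nonneg (blockSymb_nonneg hp _ _)]
    have hsum : Summable fun q : ℤ => ‖(blockSymb χ θ j q : ℂ) * hSeries c q x‖ := by
      refine (summable_norm_hSeries hc x).of_nonneg_of_le (fun _ => norm_nonneg _) fun q => ?_
      rw [norm_mul, hb]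
      exact mul_le_of_le_one_left (norm_nonneg _) (blockSymb_le_one hp _ _)
    unfold blockSeries
    rw [lintegral_enorm_tsum_ch_sq hsum]
    congr 2 with q
    rw [enorm_mul, mul_pow, ← ofReal_norm (blockSymb χ θ j q : ℂ), hb]
  simp_rw [hpars]
  calc _ = ENNReal.ofReal (2 * π) * ∑' q : ℤ, (∑' k : {j : ℤ // -1 ≤ j},
        ENNReal.ofReal ((2 : ℝ) ^ (2 * (k.1 : ℝ) * s)) *
          ENNReal.ofReal (blockSymb χ θ k.1 q) ^ 2) * ‖hSeries c q x‖ₑ ^ 2 := by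
        simp_rw [← ENNReal.tsum_mul_right, ← ENNReal.tsum_mul_left]
        rw [ENNReal.tsum_comm]
        refine tsum_congr fun q => tsum_congr fun k => ?_
        ring
    _ ≤ ENNReal.ofReal (2 * π) * ∑' q : ℤ,
          ENNReal.ofReal (K * (1 + (q : ℝ) ^ 2) ^ s) * ‖hSeries c q x‖ₑ ^ 2 := by
        gcongr with q
        exact hw q
    _ = _ := by
        simp_rw [ENNReal.ofReal_mul hK.le, mul_assoc]
        rw [ENNReal.tsum_mul_left, ENNReal.ofReal_mul (by positivity), vertSq,
          ← mul_assoc, ← ENNReal.ofReal_mul (by positivity)]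
        congr 1
        rw [← ENNReal.ofReal_mul (by positivity)]
        ring_nf

lemma tsum_lintegral_rpow_four_thirds_le {α β ι : Type*} [MeasurableSpace α] [MeasurableSpace β]
    [Countable ι] {μ : Measure α} {ν : Measure β} [SFinite μ] [SFinite ν] (w : ι → ENNReal)
    {F : ι → α → β → ENNReal} (hF : ∀ i, Measurable fun z : α × β => F i z.1 z.2)
    {V : α → ENNReal} (hV : Measurable V) (hV0 : ∀ x, V x ≠ 0) (hVt : ∀ᵐ x ∂μ, V x ≠ ⊤) :
    ∑' i, w i * ∫⁻ y, (∫⁻ x, F i x y ^ (4 / 3 : ℝ) ∂μ) ^ (3 / 2 : ℝ) ∂ν ≤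
      (∫⁻ x, (∑' i, w i * ∫⁻ y, F i x y ^ 2 ∂ν) * (V x)⁻¹ ∂μ) *
        (∫⁻ x, V x ^ 2 ∂μ) ^ (1 / 2 : ℝ) := by
  have hF2V : ∀ i, Measurable fun x => (∫⁻ y, F i x y ^ 2 ∂ν) * (V x)⁻¹ := fun i =>
    (Measurable.lintegral_prod_right' (f := fun z : α × β => F i z.1 z.2 ^ 2)
      ((hF i).pow_const 2)).mul hV.inv
  have hFV : ∀ i, Measurable fun z : α × β => F i z.1 z.2 ^ 2 * (V z.1)⁻¹ := fun i =>
    ((hF i).pow_const 2).mul (hV.comp measurable_fst).inv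
  have hswap : ∀ i, ∫⁻ y, ∫⁻ x, F i x y ^ 2 * (V x)⁻¹ ∂μ ∂ν =
      ∫⁻ x, (∫⁻ y, F i x y ^ 2 ∂ν) * (V x)⁻¹ ∂μ := fun i => by
    rw [← lintegral_lintegral_swap (hFV i).aemeasurable]
    refine lintegral_congr fun x => lintegral_mul_const _ ?_
    exact ((hF i).comp measurable_prodMk_left).pow_const 2
  calc ∑' i, w i * ∫⁻ y, (∫⁻ x, F i x y ^ (4 / 3 : ℝ) ∂μ) ^ (3 / 2 : ℝ) ∂ν
      ≤ ∑' i, w i * ∫⁻ y, (∫⁻ x, F i x y ^ 2 * (V x)⁻¹ ∂μ) *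
          (∫⁻ x, V x ^ 2 ∂μ) ^ (1 / 2 : ℝ) ∂ν := by
        gcongr with i y
        exact lintegral_rpow_four_thirds_le ((hF i).comp measurable_prodMk_right) hV hV0 hVt
    _ = (∑' i, w i * ∫⁻ x, (∫⁻ y, F i x y ^ 2 ∂ν) * (V x)⁻¹ ∂μ) *
          (∫⁻ x, V x ^ 2 ∂μ) ^ (1 / 2 : ℝ) := by
        rw [← ENNReal.tsum_mul_right]
        refine tsum_congr fun i => ?_
        rw [lintegral_mul_const _ (Measurable.lintegral_prod_left' (hFV i)), hswap, mul_assoc]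
    _ = _ := by
        congr 1
        simp_rw [← ENNReal.tsum_mul_right, mul_assoc]
        rw [lintegral_tsum fun i => ((hF2V i).const_mul _).aemeasurable]
        exact tsum_congr fun i => (lintegral_const_mul _ (hF2V i)).symm

lemma tsum_lintegral_blockSeries_paraCoef_le {χ θ : ℝ → ℝ} (hp : IsDyadicPartition χ θ)
    {s₀ s : ℝ} (hs₀ : 1 / 2 < s₀) (hs : 0 ≤ s) :
    ∃ C : ℝ, 0 < C ∧ ∀ G A : ℤ × ℤ → ℂ, (Summable fun k => ‖G k‖) → (Summable fun k => ‖A k‖) →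
      ∑' k, ENNReal.ofReal (aw 0 s₀ k) * ‖G k‖ₑ ^ 2 ≠ ⊤ →
      ∑' k, ENNReal.ofReal (aw (1 / 4) s k) * ‖A k‖ₑ ^ 2 ≠ ⊤ →
      ∑' k : {j : ℤ // -1 ≤ j}, ENNReal.ofReal ((2 : ℝ) ^ (2 * (k.1 : ℝ) * s)) *
        ∫⁻ y in I2pi, (∫⁻ x in I2pi,
          ‖blockSeries χ θ (paraCoef χ θ G A) k.1 x y‖ₑ ^ (4 / 3 : ℝ)) ^ (3 / 2 : ℝ) ≤
      ENNReal.ofReal C * (∑' k, ENNReal.ofReal (aw 0 s₀ k) * ‖G k‖ₑ ^ 2) *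
        ∑' k, ENNReal.ofReal (aw (1 / 4) s k) * ‖A k‖ₑ ^ 2 := by
  obtain ⟨K₁, hK₁, hblock⟩ := tsum_lintegral_blockSeries_sq_le hp hs
  obtain ⟨K₂, hK₂, hpara⟩ := vertSq_paraCoef_le hp hs
  set S := ∑' p : ℤ, (1 + (p : ℝ) ^ 2) ^ (-s₀) with hS
  have hS0 : 0 < S := (summable_one_add_sq_rpow hs₀).tsum_pos (fun p => by positivity) 0
    (by positivity)
  have hSof : ∑' p : ℤ, ENNReal.ofReal ((1 + (p : ℝ) ^ 2) ^ (-s₀)) = ENNReal.ofReal S :=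
    (ENNReal.ofReal_tsum_of_nonneg (fun p => by positivity) (summable_one_add_sq_rpow hs₀)).symm
  refine ⟨K₁ * (K₂ * (S * (2 * π))) * 24, by positivity, fun G A hG hA hGt hAt => ?_⟩
  set HG := ∑' k, ENNReal.ofReal (aw 0 s₀ k) * ‖G k‖ₑ ^ 2 with hHG
  set HA := ∑' k, ENNReal.ofReal (aw (1 / 4) s k) * ‖A k‖ₑ ^ 2 with hHA
  have hT := summable_paraCoef hp hG hA
  have hVm := measurable_vertSq s hA
  have hV2 : ∫⁻ x in I2pi, vertSq s A x ^ 2 ≤ (12 * HA) ^ 2 := lintegral_vertSq_sq_le s hA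
  have hVt : ∀ᵐ x ∂volume.restrict I2pi, vertSq s A x ≠ ⊤ := by
    have hfin : ∫⁻ x in I2pi, vertSq s A x ^ 2 ≠ ⊤ :=
      (hV2.trans_lt (by finiteness)).ne
    filter_upwards [ae_lt_top (hVm.pow_const 2) hfin] with x hx h
    simp [h] at hx
  have hγ : ∫⁻ x in I2pi, (∑' p, ‖hSeries G p x‖ₑ) ^ 2 ≤
      ENNReal.ofReal S * (ENNReal.ofReal (2 * π) * HG) := by
    rw [hHG, ← lintegral_vertSq s₀ hG, ← lintegral_const_mul _ (measurable_vertSq s₀ hG), ← hSof]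
    exact lintegral_mono fun x => tsum_enorm_hSeries_sq_le s₀ G x
  have hδ : ∀ δ : ENNReal, δ ≠ 0 → δ ≠ ⊤ →
      ∑' k : {j : ℤ // -1 ≤ j}, ENNReal.ofReal ((2 : ℝ) ^ (2 * (k.1 : ℝ) * s)) *
        ∫⁻ y in I2pi, (∫⁻ x in I2pi,
          ‖blockSeries χ θ (paraCoef χ θ G A) k.1 x y‖ₑ ^ (4 / 3 : ℝ)) ^ (3 / 2 : ℝ) ≤
      ENNReal.ofReal (K₁ * (K₂ * (S * (2 * π))) * 24) * HG * (HA + δ) := fun δ hδ0 hδt => by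
    refine (tsum_lintegral_rpow_four_thirds_le (μ := volume.restrict I2pi)
      (ν := volume.restrict I2pi) (fun k : {j : ℤ // -1 ≤ j} =>
        ENNReal.ofReal ((2 : ℝ) ^ (2 * (k.1 : ℝ) * s)))
      (F := fun k x y => ‖blockSeries χ θ (paraCoef χ θ G A) k.1 x y‖ₑ)
      (fun k => (measurable_blockSeries hp hT k.1).enorm)
      (hVm.add_const δ) (fun x => by simp [hδ0])
      (hVt.mono fun x hx => ENNReal.add_ne_top.2 ⟨hx, hδt⟩)).trans ?_
    have h1 : ∫⁻ x in I2pi, (∑' k : {j : ℤ // -1 ≤ j},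
        ENNReal.ofReal ((2 : ℝ) ^ (2 * (k.1 : ℝ) * s)) *
          ∫⁻ y in I2pi, ‖blockSeries χ θ (paraCoef χ θ G A) k.1 x y‖ₑ ^ 2) *
            (vertSq s A x + δ)⁻¹ ≤
        ENNReal.ofReal K₁ * (ENNReal.ofReal K₂ *
          (ENNReal.ofReal S * (ENNReal.ofReal (2 * π) * HG))) := by
      calc _ ≤ ∫⁻ x in I2pi, ENNReal.ofReal K₁ *
            (ENNReal.ofReal K₂ * (∑' p, ‖hSeries G p x‖ₑ) ^ 2) := by
            refine lintegral_mono fun x => ?_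
            calc _ ≤ (ENNReal.ofReal K₁ * (ENNReal.ofReal K₂ * (∑' p, ‖hSeries G p x‖ₑ) ^ 2 *
                  (vertSq s A x + δ))) * (vertSq s A x + δ)⁻¹ := by
                  gcongr
                  refine (hblock _ hT x).trans ?_
                  gcongr
                  refine (hpara G A hG hA x).trans ?_
                  gcongr
                  exact le_self_add
              _ ≤ _ := by
                  rw [← mul_assoc, mul_assoc]
                  exact mul_le_of_le_one_right' (ENNReal.mul_inv_le_one _)
        _ ≤ _ := by
            rw [lintegral_const_mul' _ _ ENNReal.ofReal_ne_top,
              lintegral_const_mul' _ _ ENNReal.ofReal_ne_top]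
            gcongr
    have h2 : (∫⁻ x in I2pi, (vertSq s A x + δ) ^ 2) ^ (1 / 2 : ℝ) ≤ 24 * (HA + δ) := by
      have h3 : ∫⁻ x in I2pi, (vertSq s A x + δ) ^ 2 ≤ (24 * (HA + δ)) ^ 2 := by
        calc ∫⁻ x in I2pi, (vertSq s A x + δ) ^ 2
            ≤ ∫⁻ x in I2pi, (4 * vertSq s A x ^ 2 + 4 * δ ^ 2) := by
              refine lintegral_mono fun x => ?_
              rcases le_total (vertSq s A x) δ with h | h
              · calc (vertSq s A x + δ) ^ 2 ≤ (δ + δ) ^ 2 := by gcongr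
                  _ = 4 * δ ^ 2 := by ring
                  _ ≤ _ := le_add_self
              · calc (vertSq s A x + δ) ^ 2 ≤ (vertSq s A x + vertSq s A x) ^ 2 := by gcongr
                  _ = 4 * vertSq s A x ^ 2 := by ring
                  _ ≤ _ := le_self_add
          _ ≤ 4 * (12 * HA) ^ 2 + 4 * δ ^ 2 * 8 := by
              rw [lintegral_add_right _ measurable_const,
                lintegral_const_mul _ (hVm.pow_const 2), lintegral_const,
                Measure.restrict_apply_univ, volume_I2pi]
              gcongr
              rw [show (8 : ENNReal) = ENNReal.ofReal 8 by simp]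
              exact ENNReal.ofReal_le_ofReal (by linarith [Real.pi_lt_d2])
          _ ≤ (24 * HA) ^ 2 + (24 * δ) ^ 2 := by
              ring_nf
              gcongr
              norm_num
          _ ≤ _ := by
              rw [mul_add, add_sq]
              gcongr
              exact le_self_add
      calc _ ≤ ((24 * (HA + δ)) ^ 2) ^ (1 / 2 : ℝ) := by gcongr
        _ = _ := by
          rw [← ENNReal.rpow_natCast, ← ENNReal.rpow_mul]
          norm_num
    refine (mul_le_mul' h1 h2).trans_eq ?_
    have h24 : ENNReal.ofReal (K₁ * (K₂ * (S * (2 * π))) * 24) = ENNReal.ofReal K₁ *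
        (ENNReal.ofReal K₂ * (ENNReal.ofReal S * ENNReal.ofReal (2 * π))) * 24 := by
      rw [ENNReal.ofReal_mul (by positivity), ENNReal.ofReal_mul hK₁.le,
        ENNReal.ofReal_mul hK₂.le, ENNReal.ofReal_mul hS0.le, ENNReal.ofReal_ofNat]
    rw [h24]
    ring
  have hlim : Tendsto (fun n : ℕ =>
      ENNReal.ofReal (K₁ * (K₂ * (S * (2 * π))) * 24) * HG * (HA + (n : ENNReal)⁻¹)) atTop
      (nhds (ENNReal.ofReal (K₁ * (K₂ * (S * (2 * π))) * 24) * HG * (HA + 0))) :=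
    ENNReal.Tendsto.const_mul (tendsto_const_nhds.add ENNReal.tendsto_inv_nat_nhds_zero)
      (Or.inr (by finiteness))
  rw [add_zero] at hlim
  refine ge_of_tendsto hlim ?_
  filter_upwards [eventually_gt_atTop 0] with n hn
  exact hδ _ (by simp) (by simp [hn.ne'])

lemma ofReal_L2vL43h_sq_le (f : ℝ × ℝ → ℂ) :
    ENNReal.ofReal (L2vL43h f ^ 2) ≤
      ∫⁻ y in I2pi, (∫⁻ x in I2pi, ‖f (x, y)‖ₑ ^ (4 / 3 : ℝ)) ^ (3 / 2 : ℝ) := by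
  have h0 : ∀ y, 0 ≤ ∫ x in I2pi, ‖f (x, y)‖ ^ ((4 : ℝ) / 3) := fun y =>
    integral_nonneg fun x => by positivity
  have h1 : ∀ y, 0 ≤ (∫ x in I2pi, ‖f (x, y)‖ ^ ((4 : ℝ) / 3)) ^ ((3 : ℝ) / 2) := fun y =>
    Real.rpow_nonneg (h0 y) _
  rw [L2vL43h, Real.sq_sqrt (integral_nonneg h1)]
  refine (ofReal_integral_le_lintegral_ofReal h1).trans (lintegral_mono fun y => ?_)
  dsimp only
  rw [← ENNReal.ofReal_rpow_of_nonneg (h0 y) (by norm_num)]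
  gcongr
  refine (ofReal_integral_le_lintegral_ofReal fun x => by positivity).trans_eq ?_
  refine lintegral_congr fun x => ?_
  rw [← ENNReal.ofReal_rpow_of_nonneg (norm_nonneg _) (by norm_num), ofReal_norm]

lemma ofReal_tsum_le {ι : Type*} {f : ι → ℝ} (hf : ∀ i, 0 ≤ f i) :
    ENNReal.ofReal (∑' i, f i) ≤ ∑' i, ENNReal.ofReal (f i) := by
  by_cases h : Summable f
  · exact (ENNReal.ofReal_tsum_of_nonneg hf h).le
  · simp [tsum_eq_zero_of_not_summable h]

/-- paraproduct estimate
`(Σ_{k≥−1} 2^{2ks} ‖Δ^v_k(T^v_g a)‖²_{L²_v(L^{4/3}_h)})^{1/2} ≤ C ‖g‖_{H^{0,s₀}} ‖a‖_{H^{1/4,s}}`. -/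
theorem paraproduct_Tv_estimate' (χ θ : ℝ → ℝ) (hp : IsDyadicPartition χ θ)
    (s₀ s : ℝ) (hs₀ : 1/2 < s₀) (hs : s₀ ≤ s) :
    ∃ C > 0, ∀ a g : ℝ × ℝ → ℝ, Smooth a → Per a → Smooth g → Per g →
      Real.sqrt (∑' k : {j : ℤ // -1 ≤ j},
          (2 : ℝ) ^ (2 * (k.1 : ℝ) * s) * L2vL43h (LPC χ θ k.1 (Tv χ θ g a)) ^ 2) ≤
        C * HN 0 s₀ g * HN (1/4) s a := by
  obtain ⟨C, hC, h⟩ := tsum_lintegral_blockSeries_paraCoef_le hp hs₀ (s := s) (by linarith)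
  refine ⟨√C, Real.sqrt_pos.2 hC, fun a g ha hPa hg hPg => ?_⟩
  have hG := summable_norm_fc hg hPg
  have hA := summable_norm_fc ha hPa
  have hH0 : ∀ t t' f, 0 ≤ HSq t t' f := fun t t' f =>
    tsum_nonneg fun k => by unfold aw; positivity
  have hmain := h (fc g) (fc a) hG hA
  rw [← ofReal_HSq hg hPg, ← ofReal_HSq ha hPa] at hmain
  replace hmain := hmain ENNReal.ofReal_ne_top ENNReal.ofReal_ne_top
  rw [← ENNReal.ofReal_mul hC.le, ← ENNReal.ofReal_mul (mul_nonneg hC.le (hH0 _ _ _))] at hmain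
  rw [HN, HN, ← Real.sqrt_mul hC.le, ← Real.sqrt_mul (mul_nonneg hC.le (hH0 _ _ _))]
  refine Real.sqrt_le_sqrt ((ENNReal.ofReal_le_ofReal_iff
    (mul_nonneg (mul_nonneg hC.le (hH0 _ _ _)) (hH0 _ _ _))).1 (le_trans ?_ hmain))
  refine (ofReal_tsum_le fun k => by positivity).trans (ENNReal.tsum_le_tsum fun k => ?_)
  rw [ENNReal.ofReal_mul (by positivity)]
  gcongr
  refine (ofReal_L2vL43h_sq_le _).trans_eq ?_
  simp_rw [LPC_Tv_eq hp hG hA]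
  rfl

end Aniso
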